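/- Let B be a separable C*-algebra, D a C*-algebra, I a closed two-sided ideal of D, and q: D → D/I the quotient map. Let φ_λ: B → D/I, λ ∈ [1,∞), be an asymptotic homomorphism and ψ: B → D/I a *-homomorphism that is homotopic to (φ_λ), i.e., there is an asymptotic homomorphism (Φ_λ): B → C([0,1], D/I) with ev_1∘Φ_λ = φ_λ and ev_0∘Φ_λ = ψ for every λ. Suppose ψ lifts to an asymptotic homomorphism from B to D. Then (φ_λ) lifts to an asymptotic homomorphism from B to D (i.e., there is an asymptotic homomorphism (γ_λ): B → D with q∘γ_λ = φ_λ for each λ). Moreover, the whole homotopy lifts: there is an asymptotic homomorphism (Θ_λ): B → C([0,1], D) which lifts (Φ_λ) pointwise in λ. -/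

import Mathlib

open Filter Topology

noncomputable section

/-- A (continuous) asymptotic homomorphism between C*-algebras, indexed by `ℝ≥0`. -/
def IsAsymptoticHom {A B : Type*} [NonUnitalCStarAlgebra A] [NonUnitalCStarAlgebra B]
    (f : NNReal → A → B) : Prop :=
  (∀ a : A, Continuous fun t => f t a) ∧
  (∀ a b : A, Tendsto (fun t => ‖f t (a * b) - f t a * f t b‖) atTop (𝓝 0)) ∧
  (∀ (μ₁ μ₂ : ℂ) (a b : A),
    Tendsto (fun t => ‖f t (μ₁ • a + μ₂ • b) - (μ₁ • f t a + μ₂ • f t b)‖) atTop (𝓝 0)) ∧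
  (∀ a : A, Tendsto (fun t => ‖f t (star a) - star (f t a)‖) atTop (𝓝 0))

/-- Approximate selection. -/
theorem exists_continuous_approx_lift {X V W : Type*} [TopologicalSpace X] [T2Space X]
    [ParacompactSpace X] [NormedAddCommGroup V]
    [NormedSpace ℝ V] [NormedAddCommGroup W] [NormedSpace ℝ W] (p : V →L[ℝ] W) {C : ℝ}
    (hC : 0 < C) (hp : ∀ y, ∃ v, p v = y ∧ ‖v‖ ≤ C * ‖y‖) {r : X → W} (hr : Continuous r)
    {ε : ℝ} (hε : 0 < ε) :
    ∃ g : X → V, Continuous g ∧ ∀ x, ‖r x - p (g x)‖ < ε ∧ ‖g x‖ < C * (‖r x‖ + ε) := by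
  suffices h : ∃ g : C(X, V), ∀ x, g x ∈ {v : V | ‖r x - p v‖ < ε ∧ ‖v‖ < C * (‖r x‖ + ε)} by
    obtain ⟨g, hg⟩ := h
    exact ⟨g, g.continuous, hg⟩
  apply exists_continuous_forall_mem_convex_of_local_const
  · intro x
    have h1 : Convex ℝ {v : V | ‖r x - p v‖ < ε} := by
      have := (convex_ball (r x) ε).is_linear_preimage p.isBoundedLinearMap.toIsLinearMap
      convert this using 1
      ext v
      simp [dist_eq_norm, norm_sub_rev]
    have h2 : Convex ℝ {v : V | ‖v‖ < C * (‖r x‖ + ε)} := by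
      convert convex_ball (0 : V) (C * (‖r x‖ + ε)) using 1
      ext v; simp
    exact h1.inter h2
  · intro x
    obtain ⟨v, hv, hvn⟩ := hp (r x)
    refine ⟨v, ?_⟩
    have e1 : ∀ᶠ y in 𝓝 x, ‖r y - p v‖ < ε :=
      ((hr.sub continuous_const).norm.continuousAt).eventually_lt_const (by simpa [hv] using hε)
    have e2 : ∀ᶠ y in 𝓝 x, ‖v‖ < C * (‖r y‖ + ε) :=
      Tendsto.eventually_const_lt (hvn.trans_lt (mul_lt_mul_of_pos_left (lt_add_of_pos_right _ hε) hC))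
        (continuous_const.mul (hr.norm.add continuous_const)).continuousAt
    filter_upwards [e1, e2] with y h1 h2 using ⟨h1, h2⟩

/-- **Bartle–Graves.** A continuous linear surjection of Banach spaces has a continuous right
inverse which vanishes at `0` and is bounded on bounded sets. -/
theorem exists_continuous_rightInverse {V W : Type*} [NormedAddCommGroup V] [NormedSpace ℝ V]
    [CompleteSpace V] [NormedAddCommGroup W] [NormedSpace ℝ W] [CompleteSpace W]
    (p : V →L[ℝ] W) (hp : Function.Surjective p) :
    ∃ σ : W → V, Continuous σ ∧ (∀ y, p (σ y) = y) ∧ σ 0 = 0 ∧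
      ∃ C, ∀ y, ‖σ y‖ ≤ C * (‖y‖ + 1) := by
  obtain ⟨C, hC, hp'⟩ := p.exists_preimage_norm_le hp
  choose! G hGc hG using fun (r : W → W) (hr : Continuous r) (n : ℕ) =>
    exists_continuous_approx_lift p hC hp' hr (pow_pos (by norm_num : (0 : ℝ) < 1 / 2) n)
  let r : ℕ → W → W := fun n => Nat.rec id (fun n r y => r y - p (G r n y)) n
  have hr : ∀ n, Continuous (r n) := by
    intro n
    induction n with
    | zero => exact continuous_id
    | succ n ih => exact ih.sub (p.continuous.comp (hGc _ ih n))
  have hr1 : ∀ n y, ‖r (n + 1) y‖ < (1 / 2) ^ n := fun n y => (hG _ (hr n) n y).1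
  have hg0 : ∀ y, ‖G (r 0) 0 y‖ ≤ C * (‖y‖ + 1) := fun y => by
    have := (hG _ (hr 0) 0 y).2
    simpa [r] using this.le
  have hg1 : ∀ n y, ‖G (r (n + 1)) (n + 1) y‖ ≤ C * 2 * (1 / 2) ^ n := fun n y => by
    have h1 := (hG _ (hr (n + 1)) (n + 1) y).2
    have h2 := hr1 n y
    have h3 : (0 : ℝ) < (1 / 2) ^ n := by positivity
    rw [pow_succ] at h1
    nlinarith
  have hsum : Summable fun n : ℕ => C * 2 * (1 / 2 : ℝ) ^ n :=
    summable_geometric_two.mul_left _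
  have hs1 : ∀ y, Summable fun n => G (r (n + 1)) (n + 1) y := fun y =>
    Summable.of_norm_bounded hsum (fun n => hg1 n y)
  let τ : W → V := fun y => ∑' n, G (r (n + 1)) (n + 1) y
  have hτ : Continuous τ := continuous_tsum (fun n => hGc _ (hr (n + 1)) (n + 1)) hsum hg1
  have hτn : ∀ y, ‖τ y‖ ≤ C * 4 := fun y => by
    have := tsum_of_norm_bounded (hsum.hasSum) (fun n => hg1 n y)
    rw [tsum_mul_left, tsum_geometric_two] at this
    linarith
  have hpτ : ∀ y, p (τ y) = r 1 y := fun y => by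
    have h1 : HasSum (fun n => p (G (r (n + 1)) (n + 1) y)) (p (τ y)) :=
      p.hasSum (hs1 y).hasSum
    have h2 : Tendsto (fun n => ∑ i ∈ Finset.range n, p (G (r (i + 1)) (i + 1) y)) atTop
        (𝓝 (r 1 y - 0)) := by
      have h3 : ∀ n, ∑ i ∈ Finset.range n, p (G (r (i + 1)) (i + 1) y) = r 1 y - r (n + 1) y := by
        intro n
        refine Eq.trans ?_ (Finset.sum_range_sub' (fun i => r (i + 1) y) n)
        refine Finset.sum_congr rfl fun i _ => ?_
        change _ = r (i + 1) y - (r (i + 1) y - p (G (r (i + 1)) (i + 1) y))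
        abel
      simp_rw [h3]
      refine tendsto_const_nhds.sub ?_
      exact squeeze_zero_norm (fun n => (hr1 n y).le)
        (tendsto_pow_atTop_nhds_zero_of_lt_one (by norm_num) (by norm_num))
    rw [sub_zero] at h2
    exact tendsto_nhds_unique h1.tendsto_sum_nat h2
  let σ₁ : W → V := fun y => G (r 0) 0 y + τ y
  have hσ₁ : ∀ y, p (σ₁ y) = y := fun y => by
    simp only [σ₁, map_add, hpτ]
    change p (G (r 0) 0 y) + (r 0 y - p (G (r 0) 0 y)) = y
    simp [r]
  have hσb : ∀ y, ‖σ₁ y‖ ≤ 5 * C * (‖y‖ + 1) := fun y => by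
    have := norm_add_le (G (r 0) 0 y) (τ y)
    have := hg0 y
    have := hτn y
    have := norm_nonneg y
    simp only [σ₁]
    nlinarith
  refine ⟨fun y => σ₁ y - σ₁ 0, ((hGc _ (hr 0) 0).add hτ).sub continuous_const, fun y => ?_,
    sub_self _, 10 * C, fun y => ?_⟩
  · rw [map_sub, hσ₁, hσ₁, sub_zero]
  · have := norm_sub_le (σ₁ y) (σ₁ 0)
    have h1 := hσb y
    have h2 := hσb 0
    rw [norm_zero] at h2
    have := norm_nonneg y
    nlinarith

theorem exists_star_mul_self_eq_two_smul_sub {A : Type*} [NonUnitalCStarAlgebra A] {a : A}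
    (ha : ‖a‖ ≤ 1) : ∃ b : A, star b = b ∧ star a * a = (2 : ℂ) • b + (-1 : ℂ) • (star b * b) := by
  let := CStarAlgebra.spectralOrder A
  have := CStarAlgebra.spectralOrderedRing A
  have hsa : IsSelfAdjoint (star a * a) := IsSelfAdjoint.star_mul_self a
  let f : ℝ → ℝ := fun x => 1 - √(1 - x)
  have hf : Continuous f := by fun_prop
  have hf0 : f 0 = 0 := by simp [f]
  have hs : ∀ x ∈ quasispectrum ℝ (star a * a), x ≤ 1 := fun x hx => by
    have h1 := NonUnitalIsometricContinuousFunctionalCalculus.norm_quasispectrum_le (𝕜 := ℝ) (star a * a) hx hsa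
    rw [CStarRing.norm_star_mul_self] at h1
    have := le_abs_self x
    rw [Real.norm_eq_abs] at h1
    nlinarith [norm_nonneg a]
  have hb : IsSelfAdjoint (cfcₙ f (star a * a)) := cfcₙ_predicate f _
  refine ⟨cfcₙ f (star a * a), hb, ?_⟩
  rw [hb.star_eq, ← cfcₙ_mul f f _ hf.continuousOn hf0 hf.continuousOn hf0]
  have e1 : ∀ z : A, (2 : ℂ) • z + (-1 : ℂ) • cfcₙ (fun x => f x * f x) (star a * a) =
      (2 : ℝ) • z - cfcₙ (fun x => f x * f x) (star a * a) := fun z => by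
    rw [neg_one_smul, ← sub_eq_add_neg]
    congr 1
  rw [e1, ← cfcₙ_smul (2 : ℝ) f _ hf.continuousOn hf0,
    ← cfcₙ_sub _ _ _ (by fun_prop) (by simp [hf0]) (by fun_prop) (by simp [hf0])]
  conv_lhs => rw [← cfcₙ_id ℝ (star a * a)]
  refine cfcₙ_congr fun x hx => ?_
  have h2 : √(1 - x) * √(1 - x) = 1 - x := Real.mul_self_sqrt (by linarith [hs x hx])
  simp only [f, id, smul_eq_mul]
  nlinarith

theorem norm_sq_le_of_star_mul_self_add {A : Type*} [CStarAlgebra A] [Nontrivial A] (x y : A) :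
    ‖x‖ ^ 2 ≤ 1 + ‖star x * x + star y * y - 1‖ := by
  let := CStarAlgebra.spectralOrder A
  have := CStarAlgebra.spectralOrderedRing A
  have h1 : ‖star x * x‖ ≤ ‖star x * x + star y * y‖ :=
    CStarAlgebra.norm_le_norm_of_nonneg_of_le (star_mul_self_nonneg x)
      (le_add_of_nonneg_right (star_mul_self_nonneg y))
  rw [CStarRing.norm_star_mul_self, ← sq] at h1
  refine h1.trans ?_
  have h2 := norm_add_le (1 : A) (star x * x + star y * y - 1)
  rwa [add_sub_cancel, CStarRing.norm_one] at h2

/-- Asymptotic homomorphisms are automatically asymptotically bounded. -/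
theorem IsAsymptoticHom.eventually_norm_le_two {A B : Type*} [NonUnitalCStarAlgebra A]
    [NonUnitalCStarAlgebra B] {f : NNReal → A → B} (hf : IsAsymptoticHom f) {a : A}
    (ha : ‖a‖ ≤ 1) : ∀ᶠ t in atTop, ‖f t a‖ ≤ 2 := by
  obtain ⟨b, hb, hab⟩ := exists_star_mul_self_eq_two_smul_sub ha
  obtain ⟨-, hm, hl, hs⟩ := hf
  have h32 : (0 : ℝ) < 1 / 32 := by norm_num
  filter_upwards [(hm (star a) a).eventually_le_const h32, (hm (star b) b).eventually_le_const h32,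
    (hl 2 (-1) b (star b * b)).eventually_le_const h32, (hs a).eventually_le_const h32,
    (hs b).eventually_le_const h32] with t e1 e2 e3 ea eb
  rw [← hab] at e3
  rw [hb] at e2 e3 eb
  set α := f t a
  set β := f t b
  set r := star α * α + star β * β - β - star β with hr
  have hreq : r = (f t (star a * a) - ((2 : ℂ) • β + (-1 : ℂ) • f t (b * b)))
      - (f t (star a * a) - f t (star a) * α) - (f t (b * b) - β * β) + (β - star β)
      - (f t (star a) - star α) * α - (β - star β) * β := by
    rw [hr]
    simp only [sub_mul, neg_one_smul, two_smul]
    abel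
  have hrn : ‖r‖ ≤ 1 / 8 + 1 / 32 * ‖α‖ + 1 / 32 * ‖β‖ := by
    rw [hreq]
    have n1 : ‖(f t (star a) - star α) * α‖ ≤ 1 / 32 * ‖α‖ :=
      (norm_mul_le _ _).trans (by gcongr)
    have n2 : ‖(β - star β) * β‖ ≤ 1 / 32 * ‖β‖ :=
      (norm_mul_le _ _).trans (by gcongr)
    refine (norm_sub_le_of_le (norm_sub_le_of_le (norm_add_le_of_le (norm_sub_le_of_le
      (norm_sub_le_of_le e3 e1) e2) eb) n1) n2).trans ?_
    linarith
  have hu : star (α : Unitization ℂ B) * α + star (1 - (β : Unitization ℂ B)) * (1 - β) - 1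
      = (r : Unitization ℂ B) := by
    rw [hr]
    simp only [Unitization.inr_sub, Unitization.inr_add, Unitization.inr_mul, Unitization.inr_star,
      star_sub, star_one]
    noncomm_ring
  have hx := norm_sq_le_of_star_mul_self_add (α : Unitization ℂ B) (1 - (β : Unitization ℂ B))
  have hy := norm_sq_le_of_star_mul_self_add (1 - (β : Unitization ℂ B)) (α : Unitization ℂ B)
  rw [add_comm (star (1 - (β : Unitization ℂ B)) * _)] at hy
  rw [hu, Unitization.norm_inr] at hx hy
  rw [Unitization.norm_inr] at hx
  have hβ : ‖β‖ ≤ 1 + ‖1 - (β : Unitization ℂ B)‖ := by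
    have := norm_sub_le (1 : Unitization ℂ B) (1 - (β : Unitization ℂ B))
    rwa [sub_sub_cancel, CStarRing.norm_one, Unitization.norm_inr] at this
  by_contra! hcon
  nlinarith [sq_nonneg (‖1 - (β : Unitization ℂ B)‖ - 1 / 8)]

theorem IsAsymptoticHom.eventually_norm_le {A B : Type*} [NonUnitalCStarAlgebra A]
    [NonUnitalCStarAlgebra B] {f : NNReal → A → B} (hf : IsAsymptoticHom f) (a : A) {ε : ℝ}
    (hε : 0 < ε) : ∀ᶠ t in atTop, ‖f t a‖ ≤ 2 * ‖a‖ + ε := by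
  set c : ℝ := ‖a‖ + ε / 4 with hc
  have hc0 : 0 < c := by positivity
  have h1 : ‖((c⁻¹ : ℝ) : ℂ) • a‖ ≤ 1 := by
    rw [norm_smul, Complex.norm_real, norm_inv, Real.norm_of_nonneg hc0.le, inv_mul_le_iff₀ hc0]
    linarith
  filter_upwards [hf.eventually_norm_le_two h1,
    (hf.2.2.1 c 0 (((c⁻¹ : ℝ) : ℂ) • a) 0).eventually_le_const
      (show (0 : ℝ) < ε / 2 by positivity)] with t h2 h3
  rw [smul_zero, add_zero, smul_smul, ← Complex.ofReal_mul, mul_inv_cancel₀ hc0.ne',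
    Complex.ofReal_one, one_smul, zero_smul, add_zero] at h3
  have h4 : ‖(c : ℂ) • f t (((c⁻¹ : ℝ) : ℂ) • a)‖ ≤ c * 2 := by
    rw [norm_smul, Complex.norm_real, Real.norm_of_nonneg hc0.le]
    gcongr
  have := norm_le_norm_add_norm_sub' (f t a) ((c : ℂ) • f t (((c⁻¹ : ℝ) : ℂ) • a))
  linarith

theorem norm_tendsto_zero_of_norm_sub {E : Type*} [SeminormedAddCommGroup E] {ι : Type*}
    {l : Filter ι} {u v : ι → E} (hu : Tendsto (fun t => ‖u t‖) l (𝓝 0))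
    (h : Tendsto (fun t => ‖v t - u t‖) l (𝓝 0)) : Tendsto (fun t => ‖v t‖) l (𝓝 0) := by
  refine squeeze_zero (fun t => norm_nonneg _) (fun t => ?_) (by simpa using h.add hu)
  simpa using norm_add_le (v t - u t) (u t)

/-- A continuous family asymptotically equal to an asymptotic homomorphism is one too. -/
theorem IsAsymptoticHom.congr {A B : Type*} [NonUnitalCStarAlgebra A]
    [NonUnitalCStarAlgebra B] {f g : NNReal → A → B} (hf : IsAsymptoticHom f)
    (hg : ∀ a, Continuous fun t => g t a)
    (h : ∀ a, Tendsto (fun t => ‖g t a - f t a‖) atTop (𝓝 0)) : IsAsymptoticHom g := by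
  have hbd : ∀ a, ∃ C, ∀ᶠ t in atTop, ‖f t a‖ ≤ C := fun a =>
    ⟨_, hf.eventually_norm_le a one_pos⟩
  have hbd' : ∀ a, ∃ C, ∀ᶠ t in atTop, ‖g t a‖ ≤ C := fun a => by
    obtain ⟨C, hC⟩ := hbd a
    refine ⟨C + 1, ?_⟩
    filter_upwards [hC, (h a).eventually_le_const one_pos] with t h1 h2
    have := norm_le_norm_add_norm_sub' (g t a) (f t a)
    linarith
  refine ⟨hg, fun a b => ?_, fun μ₁ μ₂ a b => ?_, fun a => ?_⟩
  · refine norm_tendsto_zero_of_norm_sub (hf.2.1 a b) ?_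
    obtain ⟨C, hC⟩ := hbd b
    obtain ⟨C', hC'⟩ := hbd' a
    refine squeeze_zero' (Eventually.of_forall fun t => norm_nonneg _)
      (g := fun t => ‖g t (a * b) - f t (a * b)‖ + ‖g t a - f t a‖ * C + C' * ‖g t b - f t b‖) ?_ ?_
    · filter_upwards [hC, hC'] with t h1 h2
      have e : g t (a * b) - g t a * g t b - (f t (a * b) - f t a * f t b) =
        (g t (a * b) - f t (a * b)) - (g t a - f t a) * f t b - g t a * (g t b - f t b) := by
        noncomm_ring
      rw [e]
      refine norm_sub_le_of_le (norm_sub_le_of_le le_rfl ?_) ?_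
      · exact (norm_mul_le _ _).trans (by gcongr)
      · exact (norm_mul_le _ _).trans (by gcongr)
    · simpa using ((h (a * b)).add ((h a).mul_const C)).add ((h b).const_mul C')
  · refine norm_tendsto_zero_of_norm_sub (hf.2.2.1 μ₁ μ₂ a b) ?_
    refine squeeze_zero (fun t => norm_nonneg _)
      (g := fun t => ‖g t (μ₁ • a + μ₂ • b) - f t (μ₁ • a + μ₂ • b)‖ + ‖μ₁‖ * ‖g t a - f t a‖ +
        ‖μ₂‖ * ‖g t b - f t b‖) (fun t => ?_) ?_
    · have e : g t (μ₁ • a + μ₂ • b) - (μ₁ • g t a + μ₂ • g t b) -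
          (f t (μ₁ • a + μ₂ • b) - (μ₁ • f t a + μ₂ • f t b)) =
          (g t (μ₁ • a + μ₂ • b) - f t (μ₁ • a + μ₂ • b)) - μ₁ • (g t a - f t a) -
          μ₂ • (g t b - f t b) := by
        simp only [smul_sub]; abel
      rw [e, ← norm_smul, ← norm_smul]
      exact norm_sub_le_of_le (norm_sub_le _ _) le_rfl
    · simpa using ((h _).add ((h a).const_mul ‖μ₁‖)).add ((h b).const_mul ‖μ₂‖)
  · refine norm_tendsto_zero_of_norm_sub (hf.2.2.2 a) ?_
    refine squeeze_zero (fun t => norm_nonneg _)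
      (g := fun t => ‖g t (star a) - f t (star a)‖ + ‖g t a - f t a‖) (fun t => ?_) ?_
    · have e : g t (star a) - star (g t a) - (f t (star a) - star (f t a)) =
          (g t (star a) - f t (star a)) - star (g t a - f t a) := by
        simp only [star_sub]; abel
      rw [e, ← norm_star (g t a - f t a)]
      exact norm_sub_le _ _
    · simpa using (h _).add (h a)

section bounded

open BoundedContinuousFunction

/-- A star homomorphism of C⋆-algebras as a real-linear continuous map. -/
def starHomCLM {E Q : Type*} [NonUnitalCStarAlgebra E] [NonUnitalCStarAlgebra Q]
    (q : E →⋆ₙₐ[ℂ] Q) : E →L[ℝ] Q where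
  toFun := q
  map_add' := map_add q
  map_smul' := fun r e => map_smul q (r : ℂ) e
  cont := AddMonoidHomClass.continuous_of_bound q 1 fun e => by
    simpa using NonUnitalStarAlgHom.norm_apply_le q e

@[simp]
theorem starHomCLM_apply {E Q : Type*} [NonUnitalCStarAlgebra E] [NonUnitalCStarAlgebra Q]
    (q : E →⋆ₙₐ[ℂ] Q) (e : E) : starHomCLM q e = q e := rfl

theorem continuous_starHom {E Q : Type*} [NonUnitalCStarAlgebra E] [NonUnitalCStarAlgebra Q]
    (q : E →⋆ₙₐ[ℂ] Q) : Continuous q := (starHomCLM q).continuous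

/-- The closed subspace of bounded continuous functions vanishing at infinity. -/
def vanishingAtTop (W : Type*) [NormedAddCommGroup W] [NormedSpace ℝ W] :
    Submodule ℝ (NNReal →ᵇ W) where
  carrier := {g | Tendsto g atTop (𝓝 0)}
  add_mem' := fun ha hb => by
    have := Tendsto.add ha hb
    rwa [add_zero] at this
  zero_mem' := tendsto_const_nhds
  smul_mem' := fun c g hg => by simpa using Tendsto.const_smul hg c

theorem mem_vanishingAtTop {W : Type*} [NormedAddCommGroup W] [NormedSpace ℝ W]
    {g : NNReal →ᵇ W} : g ∈ vanishingAtTop W ↔ Tendsto g atTop (𝓝 0) := Iff.rfl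

theorem isClosed_vanishingAtTop (W : Type*) [NormedAddCommGroup W] [NormedSpace ℝ W] :
    IsClosed (vanishingAtTop W : Set (NNReal →ᵇ W)) := by
  refine isClosed_of_closure_subset fun g hg => ?_
  change Tendsto g atTop (𝓝 0)
  rw [Metric.tendsto_nhds]
  intro ε hε
  obtain ⟨h, hh, hd⟩ := Metric.mem_closure_iff.1 hg (ε / 2) (half_pos hε)
  filter_upwards [Metric.tendsto_nhds.1 (mem_vanishingAtTop.1 hh) (ε / 2) (half_pos hε)] with t ht
  have h1 := dist_coe_le_dist (f := g) (g := h) t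
  have h2 := dist_triangle (g t) (h t) 0
  linarith

theorem norm_mkQ_le_of_eventually {W : Type*} [NormedAddCommGroup W] [NormedSpace ℝ W]
    {c : ℝ} (hc : 0 < c) {g : NNReal →ᵇ W} (hg : ∀ᶠ t in atTop, ‖g t‖ ≤ c) :
    ‖(vanishingAtTop W).mkQ g‖ ≤ c := by
  have hpos : ∀ t, 0 < max c ‖g t‖ := fun t => lt_max_of_lt_left hc
  have hb : ∀ t, ‖(c / max c ‖g t‖) • g t‖ ≤ c := fun t => by
    rw [norm_smul, Real.norm_of_nonneg (by have := hpos t; positivity), div_mul_eq_mul_div,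
      div_le_iff₀ (hpos t)]
    gcongr
    exact le_max_right _ _
  let g' : NNReal →ᵇ W := BoundedContinuousFunction.ofNormedAddCommGroup
    (fun t => (c / max c ‖g t‖) • g t)
    ((continuous_const.div (continuous_const.max g.continuous.norm) fun t => (hpos t).ne').smul
      g.continuous) c hb
  have h1 : (vanishingAtTop W).mkQ g = (vanishingAtTop W).mkQ g' := by
    rw [← sub_eq_zero, ← map_sub, Submodule.mkQ_apply, Submodule.Quotient.mk_eq_zero,
      mem_vanishingAtTop]
    refine tendsto_const_nhds.congr' ?_
    filter_upwards [hg] with t ht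
    change 0 = g t - (c / max c ‖g t‖) • g t
    rw [max_eq_left ht, div_self hc.ne', one_smul, sub_self]
  rw [h1]
  refine (Submodule.Quotient.norm_mk_le _ g').trans ?_
  exact (BoundedContinuousFunction.norm_le hc.le).2 hb

/-- A continuous function on `[0, ∞)` which is eventually bounded is bounded. -/
theorem exists_norm_le_of_eventually {W : Type*} [NormedAddCommGroup W] {f : NNReal → W}
    (hf : Continuous f) {c : ℝ} (h : ∀ᶠ t in atTop, ‖f t‖ ≤ c) : ∃ C, ∀ t, ‖f t‖ ≤ C := by
  obtain ⟨R, hR⟩ := eventually_atTop.1 h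
  obtain ⟨C, hC⟩ := (isCompact_Icc (a := (0 : NNReal)) (b := R)).exists_bound_of_continuousOn
    hf.continuousOn
  refine ⟨max c C, fun t => ?_⟩
  rcases le_total R t with h1 | h1
  · exact (hR t h1).trans (le_max_left _ _)
  · exact (hC t ⟨zero_le, h1⟩).trans (le_max_right _ _)

/-- Every asymptotic homomorphism into a quotient agrees asymptotically with the image of a
uniformly continuous family of bounded paths in the covering algebra. -/
theorem IsAsymptoticHom.exists_continuous_lift {B E Q : Type*} [NonUnitalCStarAlgebra B]
    [NonUnitalCStarAlgebra E] [NonUnitalCStarAlgebra Q] {f : NNReal → B → Q}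
    (hf : IsAsymptoticHom f) (q : E →⋆ₙₐ[ℂ] Q) (hq : Function.Surjective q) :
    ∃ x : B → (NNReal →ᵇ E), Continuous x ∧
      ∀ b, Tendsto (fun t => ‖q (x b t) - f t b‖) atTop (𝓝 0) := by
  have hbd : ∀ b, ∃ C, ∀ t, ‖f t b‖ ≤ C := fun b =>
    exists_norm_le_of_eventually (hf.1 b) (hf.eventually_norm_le b one_pos)
  choose C hC using hbd
  let F : B → (NNReal →ᵇ Q) := fun b =>
    BoundedContinuousFunction.ofNormedAddCommGroup (fun t => f t b) (hf.1 b) (C b) (hC b)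
  have := isClosed_vanishingAtTop Q
  let c : B → (NNReal →ᵇ Q) ⧸ vanishingAtTop Q := fun b => (vanishingAtTop Q).mkQ (F b)
  have hc : Continuous c := by
    refine (LipschitzWith.of_dist_le_mul (K := 2) fun a b => ?_).continuous
    rw [dist_eq_norm, dist_eq_norm, ← map_sub]
    refine le_of_forall_pos_le_add fun ε hε => ?_
    refine norm_mkQ_le_of_eventually (by positivity) ?_
    filter_upwards [hf.eventually_norm_le (a - b) (half_pos hε),
      (hf.2.2.1 1 (-1) a b).eventually_le_const (half_pos hε)] with t h1 h2
    simp only [one_smul, neg_one_smul, ← sub_eq_add_neg] at h2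
    have h3 := norm_le_norm_add_norm_sub (f t (a - b)) (f t a - f t b)
    change ‖f t a - f t b‖ ≤ _
    simp only [NNReal.coe_ofNat]
    linarith
  let qR : E →L[ℝ] Q := starHomCLM q
  obtain ⟨σ, hσ, hσq, hσ0, K, hK⟩ := exists_continuous_rightInverse qR hq
  let p : (NNReal →ᵇ E) →L[ℝ] (NNReal →ᵇ Q) ⧸ vanishingAtTop Q :=
    (vanishingAtTop Q).mkQL.comp (qR.compLeftContinuousBounded NNReal)
  have hp : Function.Surjective p := fun y => by
    obtain ⟨g, rfl⟩ := (vanishingAtTop Q).mkQ_surjective y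
    have hK0 : 0 ≤ K := by
      have := (norm_nonneg _).trans (hK 0)
      simpa using this
    refine ⟨BoundedContinuousFunction.ofNormedAddCommGroup (fun t => σ (g t))
      (hσ.comp g.continuous) (K * (‖g‖ + 1)) (fun t => (hK _).trans ?_), ?_⟩
    · gcongr
      exact g.norm_coe_le_norm t
    · change (vanishingAtTop Q).mkQ _ = (vanishingAtTop Q).mkQ g
      congr 1
      ext t
      exact hσq (g t)
  obtain ⟨S, hS, hSp, -⟩ := exists_continuous_rightInverse p hp
  refine ⟨fun b => S (c b), hS.comp hc, fun b => ?_⟩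
  have h1 : (vanishingAtTop Q).mkQ (qR.compLeftContinuousBounded NNReal (S (c b))) =
    (vanishingAtTop Q).mkQ (F b) := hSp (c b)
  rw [← sub_eq_zero, ← map_sub, Submodule.mkQ_apply, Submodule.Quotient.mk_eq_zero,
    mem_vanishingAtTop] at h1
  have h2 := h1.norm
  rwa [norm_zero] at h2

end bounded

/-- The kernel of a star homomorphism, as a star subalgebra. -/
def starHomKer {A P : Type*} [NonUnitalCStarAlgebra A] [NonUnitalCStarAlgebra P]
    (π : A →⋆ₙₐ[ℂ] P) : NonUnitalStarSubalgebra ℂ A where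
  carrier := {a | π a = 0}
  add_mem' := fun {a b} (ha : π a = 0) (hb : π b = 0) => by
    change π (a + b) = 0
    rw [map_add, ha, hb, add_zero]
  zero_mem' := map_zero π
  mul_mem' := fun {a b} (ha : π a = 0) (_ : π b = 0) => by
    change π (a * b) = 0
    rw [map_mul, ha, zero_mul]
  smul_mem' := fun c a (ha : π a = 0) => by
    change π (c • a) = 0
    rw [map_smul, ha, smul_zero]
  star_mem' := fun {a} (ha : π a = 0) => by
    change π (star a) = 0
    rw [map_star, ha, star_zero]

theorem exists_approximate_unit_ker {A P : Type*} [NonUnitalCStarAlgebra A]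
    [NonUnitalCStarAlgebra P] (π : A →⋆ₙₐ[ℂ] P) (L : Finset A) (hL : ∀ l ∈ L, π l = 0) {ε : ℝ}
    (hε : 0 < ε) : ∃ v, π v = 0 ∧ ‖star v * v‖ ≤ 1 ∧
      ∀ l ∈ L, ‖l - star v * v * l‖ ≤ ε ∧ ‖l - l * (star v * v)‖ ≤ ε := by
  have hcl : IsClosed (starHomKer π : Set A) :=
    isClosed_eq (continuous_starHom π) continuous_const
  let _ := CStarAlgebra.spectralOrder (starHomKer π)
  have := CStarAlgebra.spectralOrderedRing (starHomKer π)
  have hau := CStarAlgebra.increasingApproximateUnit (starHomKer π)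
  have hne := hau.neBot
  have h1 : ∀ᶠ u : starHomKer π in CStarAlgebra.approximateUnit (starHomKer π), ∀ l ∈ L,
      ‖l - u * l‖ ≤ ε ∧ ‖l - l * u‖ ≤ ε := by
    rw [Filter.eventually_all_finset]
    intro l hl
    let l' : starHomKer π := ⟨l, hL l hl⟩
    have e1 : Tendsto (fun u => ‖l' - u * l'‖) (CStarAlgebra.approximateUnit (starHomKer π))
        (𝓝 ‖l' - l'‖) := (tendsto_const_nhds.sub (hau.tendsto_mul_right l')).norm
    have e2 : Tendsto (fun u => ‖l' - l' * u‖) (CStarAlgebra.approximateUnit (starHomKer π))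
        (𝓝 ‖l' - l'‖) := (tendsto_const_nhds.sub (hau.tendsto_mul_left l')).norm
    rw [sub_self, norm_zero] at e1 e2
    filter_upwards [e1.eventually_le_const hε, e2.eventually_le_const hε] with u h1 h2
    exact ⟨h1, h2⟩
  obtain ⟨u, hu, hu0, hu1⟩ := (h1.and (hau.eventually_nonneg.and hau.eventually_norm)).exists
  obtain ⟨v, hv⟩ := CStarAlgebra.nonneg_iff_eq_star_mul_self.1 hu0
  have hv' : (u : A) = star (v : A) * v := by rw [hv]; rfl
  refine ⟨v, v.2, ?_, ?_⟩
  · rw [← hv']; exact hu1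
  · rw [← hv']; exact hu

theorem norm_add_sq_le {A : Type*} [NonUnitalCStarAlgebra A] (c d : A) :
    ‖c + d‖ ^ 2 ≤ ‖c‖ ^ 2 + ‖d‖ ^ 2 + 2 * ‖star c * d‖ := by
  rw [sq, ← CStarRing.norm_star_mul_self]
  have e : star (c + d) * (c + d) = star c * c + star d * d + (star c * d + star (star c * d)) := by
    simp only [star_add, star_mul, star_star]
    noncomm_ring
  rw [e]
  refine (norm_add_le_of_le (norm_add_le _ _) (norm_add_le _ _)).trans ?_
  rw [norm_star, CStarRing.norm_star_mul_self, CStarRing.norm_star_mul_self]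
  linarith

theorem exists_quasicentral_sum {A P : Type*} [NonUnitalCStarAlgebra A] [PartialOrder A]
    [StarOrderedRing A]
    [NonUnitalCStarAlgebra P] (π : A →⋆ₙₐ[ℂ] P) (F L : Finset A) (hL : ∀ l ∈ L, π l = 0) {ε : ℝ}
    (hε : 0 < ε) {M : ℝ} (hM : ∀ d ∈ F, ‖d‖ ≤ M) (hM0 : 0 ≤ M) (N : ℕ) :
    ∃ s, π s = 0 ∧ 0 ≤ s ∧ ‖s‖ ≤ N ∧ (∀ d ∈ F, ‖s * d - d * s‖ ^ 2 ≤ N * (4 * M ^ 2 + 1)) ∧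
      ∀ l ∈ L, ‖(N : ℝ) • l - s * l‖ ≤ N * ε := by
  classical
  induction N with
  | zero => exact ⟨0, by simp⟩
  | succ N ih =>
    obtain ⟨s, hs, hs0, hsN, hsF, hsL⟩ := ih
    set η : ℝ := min ε (1 / (2 * (M + 1))) with hη
    have hη0 : 0 < η := by positivity
    have hηM : 2 * (η * M + η) ≤ 1 := by
      have : η ≤ 1 / (2 * (M + 1)) := min_le_right _ _
      rw [le_div_iff₀ (by positivity)] at this
      linarith
    let L' : Finset A := L ∪ F.image (fun d => star (s * d - d * s)) ∪
      F.image (fun d => star (s * d - d * s) * d)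
    have hc : ∀ d, π (star (s * d - d * s)) = 0 := fun d => by
      simp [map_star, map_sub, map_mul, hs]
    have hL' : ∀ l ∈ L', π l = 0 := by
      intro l hl
      simp only [L', Finset.mem_union, Finset.mem_image] at hl
      rcases hl with (hl | ⟨d, -, rfl⟩) | ⟨d, -, rfl⟩
      · exact hL l hl
      · exact hc d
      · rw [map_mul, hc, zero_mul]
    obtain ⟨v, hv, hv1, hvL⟩ := exists_approximate_unit_ker π L' hL' hη0
    set u := star v * v with hu
    refine ⟨s + u, ?_, add_nonneg hs0 (star_mul_self_nonneg v), ?_, fun d hd => ?_, fun l hl => ?_⟩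
    · rw [map_add, hs, hu, map_mul, hv, mul_zero, add_zero]
    · push_cast
      exact norm_add_le_of_le hsN hv1
    · have e : (s + u) * d - d * (s + u) = (s * d - d * s) + (u * d - d * u) := by noncomm_ring
      rw [e]
      set c := s * d - d * s with hcdef
      have h1 := (hvL (star c) (by simp only [L', Finset.mem_union, Finset.mem_image]; exact Or.inl (Or.inr ⟨d, hd, rfl⟩))).2
      have h2 := (hvL (star c * d) (by simp only [L', Finset.mem_union, Finset.mem_image]; exact Or.inr ⟨d, hd, rfl⟩)).2
      have h3 : ‖star c * (u * d - d * u)‖ ≤ η * M + η := by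
        have e : star c * (u * d - d * u) = (star c * d - star c * d * u) - (star c - star c * u) * d := by
          noncomm_ring
        rw [e, add_comm]
        refine norm_sub_le_of_le h2 ((norm_mul_le _ _).trans ?_)
        exact mul_le_mul h1 (hM d hd) (norm_nonneg _) hη0.le
      have h4 : ‖u * d - d * u‖ ≤ 2 * M := by
        refine (norm_sub_le_of_le ((norm_mul_le _ _).trans (mul_le_mul hv1 (hM d hd) (norm_nonneg _) zero_le_one))
          ((norm_mul_le _ _).trans (mul_le_mul (hM d hd) hv1 (norm_nonneg _) hM0))).trans ?_
        linarith
      have h5 := norm_add_sq_le c (u * d - d * u)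
      have h6 := hsF d hd
      have h7 : ‖u * d - d * u‖ ^ 2 ≤ (2 * M) ^ 2 := pow_le_pow_left₀ (norm_nonneg _) h4 2
      push_cast
      linarith
    · have h1 := (hvL l (by simp only [L', Finset.mem_union]; exact Or.inl (Or.inl hl))).1
      have e : ((N + 1 : ℕ) : ℝ) • l - (s + u) * l = ((N : ℝ) • l - s * l) + (l - u * l) := by
        push_cast
        rw [add_smul, one_smul, add_mul]
        abel
      rw [e]
      push_cast
      rw [add_mul, one_mul]
      exact norm_add_le_of_le (hsL l hl) (h1.trans (min_le_left _ _))

/-- Quasi-central approximate units. -/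
theorem exists_quasicentral {A P : Type*} [NonUnitalCStarAlgebra A]
    [NonUnitalCStarAlgebra P] (π : A →⋆ₙₐ[ℂ] P) (F L : Finset A) (hL : ∀ l ∈ L, π l = 0) {ε : ℝ}
    (hε : 0 < ε) :
    ∃ v, π v = 0 ∧ ‖star v * v‖ ≤ 1 ∧ (∀ d ∈ F, ‖star v * v * d - d * (star v * v)‖ ≤ ε) ∧
      ∀ l ∈ L, ‖l - star v * v * l‖ ≤ ε := by
  let _ := CStarAlgebra.spectralOrder A
  have := CStarAlgebra.spectralOrderedRing A
  obtain ⟨M, hM0, hM⟩ : ∃ M : ℝ, 0 ≤ M ∧ ∀ d ∈ F, ‖d‖ ≤ M :=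
    ⟨∑ d ∈ F, ‖d‖, by positivity, fun d hd =>
      Finset.single_le_sum (f := fun d => ‖d‖) (fun _ _ => norm_nonneg _) hd⟩
  obtain ⟨N, hN⟩ := exists_nat_gt ((4 * M ^ 2 + 1) / ε ^ 2)
  have hN0 : (0 : ℝ) < N := lt_of_le_of_lt (by positivity) hN
  obtain ⟨s, hs, hs0, hsN, hsF, hsL⟩ := exists_quasicentral_sum π F L hL hε hM hM0 N
  have hu0 : 0 ≤ (N : ℝ)⁻¹ • s := smul_nonneg (by positivity) hs0
  obtain ⟨v, hv⟩ := CStarAlgebra.nonneg_iff_eq_star_mul_self.1 hu0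
  refine ⟨v, ?_, ?_, fun d hd => ?_, fun l hl => ?_⟩
  · rw [← CStarRing.star_mul_self_eq_zero_iff, ← map_star, ← map_mul, ← hv, ← starHomCLM_apply, map_smul,
      starHomCLM_apply, hs, smul_zero]
  · rw [← hv, norm_smul, norm_inv, Real.norm_of_nonneg hN0.le, inv_mul_le_iff₀ hN0, mul_one]
    exact hsN
  · rw [← hv, smul_mul_assoc, mul_smul_comm, ← smul_sub, norm_smul, norm_inv,
      Real.norm_of_nonneg hN0.le, inv_mul_le_iff₀ hN0]
    refine abs_le_of_sq_le_sq' ((hsF d hd).trans ?_) (by positivity) |>.2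
    rw [div_lt_iff₀ (by positivity)] at hN
    nlinarith
  · have e : l - (N : ℝ)⁻¹ • s * l = (N : ℝ)⁻¹ • ((N : ℝ) • l - s * l) := by
      rw [smul_sub, smul_smul, inv_mul_cancel₀ hN0.ne', one_smul, smul_mul_assoc]
    rw [← hv, e, norm_smul, norm_inv, Real.norm_of_nonneg hN0.le, inv_mul_le_iff₀ hN0]
    exact hsL l hl

section posContraction

open Polynomial

universe u

/-- Positive elements of norm at most one. -/
def IsPosContraction {A : Type*} [NonUnitalCStarAlgebra A] (u : A) : Prop :=
  (∃ v, u = star v * v) ∧ ‖u‖ ≤ 1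

namespace IsPosContraction

theorem isSelfAdjoint {A : Type*} [NonUnitalCStarAlgebra A] {u : A} (hu : IsPosContraction u) :
    IsSelfAdjoint u := by
  obtain ⟨⟨v, rfl⟩, -⟩ := hu
  exact IsSelfAdjoint.star_mul_self v

theorem combo {A : Type*} [NonUnitalCStarAlgebra A] {u v : A} (hu : IsPosContraction u)
    (hv : IsPosContraction v) {a b : ℝ} (ha : 0 ≤ a) (hb : 0 ≤ b) (hab : a + b = 1) :
    IsPosContraction (a • u + b • v) := by
  let _ := CStarAlgebra.spectralOrder A
  have := CStarAlgebra.spectralOrderedRing A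
  refine ⟨CStarAlgebra.nonneg_iff_eq_star_mul_self.1 (add_nonneg
    (smul_nonneg ha (CStarAlgebra.nonneg_iff_eq_star_mul_self.2 hu.1))
    (smul_nonneg hb (CStarAlgebra.nonneg_iff_eq_star_mul_self.2 hv.1))), ?_⟩
  refine (norm_add_le_of_le (norm_smul_le _ _) (norm_smul_le _ _)).trans ?_
  rw [Real.norm_of_nonneg ha, Real.norm_of_nonneg hb]
  nlinarith [hu.2, hv.2]

theorem inr {A : Type*} [NonUnitalCStarAlgebra A] {u : A} (hu : IsPosContraction u) :
    IsPosContraction (u : Unitization ℂ A) := by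
  obtain ⟨⟨v, rfl⟩, h⟩ := hu
  exact ⟨⟨v, by simp⟩, by rwa [Unitization.norm_inr]⟩

theorem spectrum_subset {A : Type*} [CStarAlgebra A] {u : A}
    (hu : IsPosContraction u) : spectrum ℝ u ⊆ Set.Icc 0 1 := by
  rcases subsingleton_or_nontrivial A with h | h
  · intro x hx
    simp [Subsingleton.elim u 0, spectrum.of_subsingleton] at hx
  let _ := CStarAlgebra.spectralOrder A
  have := CStarAlgebra.spectralOrderedRing A
  intro x hx
  refine ⟨spectrum_nonneg_of_nonneg (CStarAlgebra.nonneg_iff_eq_star_mul_self.2 hu.1) hx, ?_⟩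
  exact (le_abs_self x).trans ((spectrum.norm_le_norm_of_mem hx).trans hu.2)

end IsPosContraction

theorem exists_norm_commutator_aeval_le (p : ℝ[X]) : ∃ K : ℝ, 0 ≤ K ∧
    ∀ (A : Type u) [CStarAlgebra A] [Nontrivial A] (a z : A), ‖a‖ ≤ 1 →
      ‖aeval a p * z - z * aeval a p‖ ≤ K * ‖a * z - z * a‖ ∧
      ‖aeval a p * z - p.eval 1 • z‖ ≤ K * ‖z - a * z‖ := by
  induction p using Polynomial.induction_on' with
  | add p r hp hr =>
    obtain ⟨K, hK, h⟩ := hp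
    obtain ⟨K', hK', h'⟩ := hr
    refine ⟨K + K', by positivity, fun A _ _ a z ha => ⟨?_, ?_⟩⟩
    · have e : aeval a (p + r) * z - z * aeval a (p + r) =
        (aeval a p * z - z * aeval a p) + (aeval a r * z - z * aeval a r) := by
        rw [map_add]; noncomm_ring
      rw [e, add_mul]
      exact norm_add_le_of_le (h A a z ha).1 (h' A a z ha).1
    · have e : aeval a (p + r) * z - (p + r).eval 1 • z =
        (aeval a p * z - p.eval 1 • z) + (aeval a r * z - r.eval 1 • z) := by
        rw [map_add, eval_add, add_smul, add_mul]; abel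
      rw [e, add_mul]
      exact norm_add_le_of_le (h A a z ha).2 (h' A a z ha).2
  | monomial n c =>
    refine ⟨|c| * n, by positivity, fun A _ _ a z ha => ?_⟩
    have hpow : ∀ n : ℕ, ‖a ^ n‖ ≤ 1 := fun n =>
      (norm_pow_le a n).trans (pow_le_one₀ (norm_nonneg _) ha)
    have h1 : ∀ n : ℕ, ‖a ^ n * z - z * a ^ n‖ ≤ n * ‖a * z - z * a‖ := by
      intro n
      induction n with
      | zero => simp
      | succ n ih =>
        have e : a ^ (n + 1) * z - z * a ^ (n + 1) =
            (a ^ n * z - z * a ^ n) * a + a ^ n * (a * z - z * a) := by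
          rw [pow_succ]; noncomm_ring
        rw [e]
        push_cast
        rw [add_mul, one_mul]
        refine norm_add_le_of_le ((norm_mul_le _ _).trans ?_) ((norm_mul_le _ _).trans ?_)
        · exact (mul_le_of_le_one_right (norm_nonneg _) ha).trans ih
        · exact mul_le_of_le_one_left (norm_nonneg _) (hpow n)
    have h2 : ∀ n : ℕ, ‖a ^ n * z - z‖ ≤ n * ‖z - a * z‖ := by
      intro n
      induction n with
      | zero => simp
      | succ n ih =>
        have e : a ^ (n + 1) * z - z = (a ^ n * z - z) + -(a ^ n * (z - a * z)) := by
          rw [pow_succ]; noncomm_ring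
        rw [e]
        push_cast
        rw [add_mul, one_mul]
        refine norm_add_le_of_le ih ?_
        rw [norm_neg]
        exact (norm_mul_le _ _).trans (mul_le_of_le_one_left (norm_nonneg _) (hpow n))
    have e : aeval a (monomial n c) = c • a ^ n := by
      rw [aeval_monomial, Algebra.smul_def]
    constructor
    · rw [e, smul_mul_assoc, mul_smul_comm, ← smul_sub, norm_smul, Real.norm_eq_abs, mul_assoc]
      exact mul_le_mul_of_nonneg_left (h1 n) (abs_nonneg c)
    · rw [e, eval_monomial, one_pow, mul_one, smul_mul_assoc, ← smul_sub, norm_smul,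
        Real.norm_eq_abs, mul_assoc]
      exact mul_le_mul_of_nonneg_left (h2 n) (abs_nonneg c)

/-- Continuous functions of `a` almost commute with whatever `a` almost commutes with, and almost
annihilate whatever `1 - a` almost annihilates if they vanish at `1`; both uniformly in `a`. -/
theorem exists_cfc_almost_commute {f : ℝ → ℝ} (hf : Continuous f) {ε : ℝ} (hε : 0 < ε) (C : ℝ) :
    ∃ δ : ℝ, 0 < δ ∧ ∀ (A : Type u) [CStarAlgebra A] [Nontrivial A] (a z : A),
      IsPosContraction a → ‖z‖ ≤ C →
      (‖a * z - z * a‖ ≤ δ → ‖cfc f a * z - z * cfc f a‖ ≤ ε) ∧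
      (f 1 = 0 → ‖z - a * z‖ ≤ δ → ‖cfc f a * z‖ ≤ ε) := by
  set η : ℝ := ε / (4 * (|C| + 1)) with hη
  have hη0 : 0 < η := by positivity
  have hηC : 2 * (η * |C|) ≤ ε / 2 := by
    rw [hη, div_mul_eq_mul_div, mul_div_assoc', div_le_iff₀ (by positivity)]
    nlinarith [abs_nonneg C]
  obtain ⟨p, hp⟩ := exists_polynomial_near_of_continuousOn 0 1 f hf.continuousOn η hη0
  obtain ⟨K, hK, h⟩ := exists_norm_commutator_aeval_le.{u} p
  refine ⟨ε / (2 * (K + 1)), by positivity, fun A _ _ a z ha hz => ?_⟩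
  have hsa := ha.isSelfAdjoint
  have hz' : ‖z‖ ≤ |C| := hz.trans (le_abs_self C)
  have h1 : ‖cfc f a - aeval a p‖ ≤ η := by
    rw [← cfc_polynomial p a, ← cfc_sub f (fun x => p.eval x) a hf.continuousOn
      p.continuous.continuousOn]
    refine norm_cfc_le hη0.le fun x hx => ?_
    rw [norm_sub_rev]
    exact (hp x (ha.spectrum_subset hx)).le
  have hl : ‖(cfc f a - aeval a p) * z‖ ≤ η * |C| :=
    (norm_mul_le _ _).trans (mul_le_mul h1 hz' (norm_nonneg _) hη0.le)
  have hδ : K * (ε / (2 * (K + 1))) ≤ ε / 2 := by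
    rw [mul_div_assoc', div_le_iff₀ (by positivity)]
    nlinarith
  constructor
  · intro hc
    have hr : ‖z * (cfc f a - aeval a p)‖ ≤ η * |C| := by
      rw [mul_comm η]
      exact (norm_mul_le _ _).trans (mul_le_mul hz' h1 (norm_nonneg _) (abs_nonneg C))
    have e : cfc f a * z - z * cfc f a = (cfc f a - aeval a p) * z - z * (cfc f a - aeval a p) +
        (aeval a p * z - z * aeval a p) := by noncomm_ring
    rw [e]
    refine (norm_add_le_of_le (norm_sub_le_of_le hl hr) ((h A a z ha.2).1.trans
      (mul_le_mul_of_nonneg_left hc hK))).trans ?_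
    linarith
  · intro hf1 hc
    have hp1 : ‖p.eval 1 • z‖ ≤ η * |C| := by
      rw [norm_smul]
      refine mul_le_mul ?_ hz' (norm_nonneg _) hη0.le
      have := (hp 1 (by simp)).le
      rwa [hf1, sub_zero] at this
    have e : cfc f a * z = (cfc f a - aeval a p) * z + p.eval 1 • z +
        (aeval a p * z - p.eval 1 • z) := by noncomm_ring
    rw [e]
    refine (norm_add_le_of_le (norm_add_le_of_le hl hp1) ((h A a z ha.2).2.trans
      (mul_le_mul_of_nonneg_left hc hK))).trans ?_
    linarith

end posContraction

theorem norm_sum_conjugate_le_of_nonneg {A : Type*} [CStarAlgebra A] [Nontrivial A] [PartialOrder A]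
    [StarOrderedRing A] {ι : Type*}
    (s : Finset ι) (w z : ι → A) (hw : ∀ i ∈ s, IsSelfAdjoint (w i))
    (hsum : ‖∑ i ∈ s, w i * w i‖ ≤ 1) {c : ℝ} (hc : 0 ≤ c) (hz0 : ∀ i ∈ s, 0 ≤ z i)
    (hz : ∀ i ∈ s, ‖z i‖ ≤ c) : ‖∑ i ∈ s, w i * z i * w i‖ ≤ c := by
  have h0 : 0 ≤ ∑ i ∈ s, w i * z i * w i := Finset.sum_nonneg fun i hi =>
    (hw i hi).conjugate_nonneg (hz0 i hi)
  have h1 : ∑ i ∈ s, w i * z i * w i ≤ c • ∑ i ∈ s, w i * w i := by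
    rw [Finset.smul_sum]
    refine Finset.sum_le_sum fun i hi => ?_
    have h2 : z i ≤ algebraMap ℝ A c :=
      (IsSelfAdjoint.of_nonneg (hz0 i hi)).le_algebraMap_norm_self.trans
        (algebraMap_le_algebraMap.2 (hz i hi))
    have h3 := (hw i hi).conjugate_le_conjugate h2
    rwa [Algebra.algebraMap_eq_smul_one, mul_smul_comm, mul_one, smul_mul_assoc] at h3
  refine (CStarAlgebra.norm_le_norm_of_nonneg_of_le h0 h1).trans ((norm_smul_le _ _).trans ?_)
  rw [Real.norm_of_nonneg hc]
  exact mul_le_of_le_one_right hc hsum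

theorem norm_sum_conjugate_le {A : Type*} [CStarAlgebra A] [Nontrivial A] {ι : Type*}
    (s : Finset ι) (w z : ι → A) (hw : ∀ i ∈ s, IsSelfAdjoint (w i))
    (hsum : ‖∑ i ∈ s, w i * w i‖ ≤ 1) {c : ℝ} (hc : 0 ≤ c) (hz : ∀ i ∈ s, ‖z i‖ ≤ c) :
    ‖∑ i ∈ s, w i * z i * w i‖ ≤ 4 * c := by
  let _ := CStarAlgebra.spectralOrder A
  have := CStarAlgebra.spectralOrderedRing A
  choose x hx0 hxn hx using fun i => CStarAlgebra.exists_sum_four_nonneg (z i)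
  have e : ∑ i ∈ s, w i * z i * w i =
      ∑ k : Fin 4, Complex.I ^ (k : ℕ) • ∑ i ∈ s, w i * x i k * w i := by
    simp_rw [Finset.smul_sum]
    rw [Finset.sum_comm]
    refine Finset.sum_congr rfl fun i _ => ?_
    rw [hx i, Finset.mul_sum, Finset.sum_mul]
    refine Finset.sum_congr rfl fun k _ => ?_
    rw [mul_smul_comm, smul_mul_assoc]
  rw [e]
  suffices h : ∀ k ∈ (Finset.univ : Finset (Fin 4)),
      ‖Complex.I ^ (k : ℕ) • ∑ i ∈ s, w i * x i k * w i‖ ≤ c from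
    (norm_sum_le_of_le _ h).trans (by simp)
  intro k _
  rw [norm_smul, norm_pow, Complex.norm_I, one_pow, one_mul]
  exact norm_sum_conjugate_le_of_nonneg s w (fun i => x i k) hw hsum hc (fun i _ => hx0 i k)
    fun i hi => (hxn i k).trans (hz i hi)

/-- Near-multiplicativity of conjugation by a partition of unity almost commuting with the
relevant elements. -/
theorem norm_sum_conjugate_mul_sub_le {A : Type*} [CStarAlgebra A] [Nontrivial A] {ι : Type*}
    (s : Finset ι) (w x y : ι → A) (hw : ∀ i ∈ s, IsSelfAdjoint (w i))
    (hww : ∀ i ∈ s, ∀ j ∈ s, Commute (w i) (w j)) (hw1 : ∀ i ∈ s, ‖w i‖ ≤ 1)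
    (hsum : ∑ i ∈ s, w i * w i = 1) {C ω ε : ℝ} (hC : 0 ≤ C) (hω : 0 ≤ ω)
    (hx : ∀ i ∈ s, ‖x i‖ ≤ C) (hy : ∀ i ∈ s, ‖y i‖ ≤ C)
    (hcx : ∀ i ∈ s, ∀ j ∈ s, ‖w j * x i - x i * w j‖ ≤ ε)
    (hcy : ∀ i ∈ s, ∀ j ∈ s, ‖w j * y i - y i * w j‖ ≤ ε)
    (hyy : ∀ i ∈ s, ∀ j ∈ s, w i * w j = 0 ∨ ‖y i - y j‖ ≤ ω) :
    ‖∑ i ∈ s, w i * (x i * y i) * w i - (∑ i ∈ s, w i * x i * w i) * ∑ i ∈ s, w i * y i * w i‖ ≤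
      4 * (C * ω) + (s.card : ℝ) ^ 2 * (4 * C * ε) := by
  classical
  let z : ι × ι → A := fun p => if w p.1 * w p.2 = 0 then 0 else x p.1 * (y p.1 - y p.2)
  have e1 : ∑ i ∈ s, w i * (x i * y i) * w i =
      ∑ p ∈ s ×ˢ s, w p.1 * (x p.1 * y p.1) * w p.1 * (w p.2 * w p.2) := by
    rw [Finset.sum_product]
    refine Finset.sum_congr rfl fun i _ => ?_
    dsimp only
    rw [← Finset.mul_sum, hsum, mul_one]
  have e2 : (∑ i ∈ s, w i * x i * w i) * ∑ i ∈ s, w i * y i * w i =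
      ∑ p ∈ s ×ˢ s, (w p.1 * x p.1 * w p.1) * (w p.2 * y p.2 * w p.2) := by
    rw [Finset.sum_mul_sum, Finset.sum_product]
  have e3 : ‖∑ p ∈ s ×ˢ s, (w p.1 * w p.2) * z p * (w p.1 * w p.2)‖ ≤ 4 * (C * ω) := by
    refine norm_sum_conjugate_le (s ×ˢ s) (fun p => w p.1 * w p.2) z ?_ ?_ (by positivity) ?_
    · rintro ⟨i, j⟩ hp
      rw [Finset.mem_product] at hp
      exact ((hw i hp.1).commute_iff (hw j hp.2)).1 (hww i hp.1 j hp.2)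
    · have : ∑ p ∈ s ×ˢ s, w p.1 * w p.2 * (w p.1 * w p.2) = 1 := by
        rw [Finset.sum_product]
        refine Eq.trans ?_ hsum
        refine Finset.sum_congr rfl fun i hi => ?_
        rw [← mul_one (w i * w i), ← hsum, Finset.mul_sum]
        refine Finset.sum_congr rfl fun j hj => ?_
        rw [mul_assoc, ← mul_assoc (w j), (hww j hj i hi).eq]
        noncomm_ring
      rw [this, CStarRing.norm_one]
    · rintro ⟨i, j⟩ hp
      rw [Finset.mem_product] at hp
      simp only [z]
      split_ifs with h
      · simpa using mul_nonneg hC hω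
      · exact (norm_mul_le _ _).trans (mul_le_mul (hx i hp.1)
          ((hyy i hp.1 j hp.2).resolve_left h) (norm_nonneg _) hC)
  have e4 : ∀ p ∈ s ×ˢ s, ‖(w p.1 * (x p.1 * y p.1) * w p.1 * (w p.2 * w p.2) -
      (w p.1 * x p.1 * w p.1) * (w p.2 * y p.2 * w p.2)) -
        (w p.1 * w p.2) * z p * (w p.1 * w p.2)‖ ≤ 4 * C * ε := by
    rintro ⟨i, j⟩ hp
    rw [Finset.mem_product] at hp
    obtain ⟨hi, hj⟩ := hp
    have hz : w i * w j * z (i, j) * (w i * w j) =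
        w i * w j * (x i * (y i - y j)) * (w i * w j) := by
      simp only [z]
      split_ifs with h
      · simp [h]
      · rfl
    have hij := (hww i hi j hj).eq
    have e : (w i * (x i * y i) * w i * (w j * w j) - (w i * x i * w i) * (w j * y j * w j)) -
        w i * w j * z (i, j) * (w i * w j) =
        -(w i * (w j * x i - x i * w j) * y i * w i * w j)
        - (w i * x i * (w j * y i - y i * w j) * w i * w j)
        + w i * (w j * x i - x i * w j) * w i * y j * w j
        + w i * w j * x i * -(w i * y j - y j * w i) * w j := by
      rw [hz]
      have t1 : w i * (x i * y i) * w i * (w j * w j) = w i * x i * y i * w j * w i * w j := by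
        calc _ = w i * x i * y i * (w i * w j) * w j := by noncomm_ring
          _ = _ := by rw [hij]; noncomm_ring
      have t2 : w i * x i * w i * (w j * y j * w j) = w i * x i * w j * w i * y j * w j := by
        calc _ = w i * x i * (w i * w j) * y j * w j := by noncomm_ring
          _ = _ := by rw [hij]; noncomm_ring
      rw [t1, t2]
      noncomm_ring
    have mle : ∀ {a b : A} {c d : ℝ}, ‖a‖ ≤ c → ‖b‖ ≤ d → 0 ≤ c → ‖a * b‖ ≤ c * d :=
      fun h h' hc => (norm_mul_le _ _).trans (mul_le_mul h h' (norm_nonneg _) hc)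
    have hε : 0 ≤ ε := (norm_nonneg _).trans (hcx i hi j hj)
    simp only
    rw [e]
    have n1 : ‖w i * (w j * x i - x i * w j) * y i * w i * w j‖ ≤ 1 * ε * C * 1 * 1 :=
      mle (mle (mle (mle (hw1 i hi) (hcx i hi j hj) zero_le_one) (hy i hi) (by positivity))
        (hw1 i hi) (by positivity)) (hw1 j hj) (by positivity)
    have n2 : ‖w i * x i * (w j * y i - y i * w j) * w i * w j‖ ≤ 1 * C * ε * 1 * 1 :=
      mle (mle (mle (mle (hw1 i hi) (hx i hi) zero_le_one) (hcy i hi j hj) (by positivity))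
        (hw1 i hi) (by positivity)) (hw1 j hj) (by positivity)
    have n3 : ‖w i * (w j * x i - x i * w j) * w i * y j * w j‖ ≤ 1 * ε * 1 * C * 1 :=
      mle (mle (mle (mle (hw1 i hi) (hcx i hi j hj) zero_le_one) (hw1 i hi) (by positivity))
        (hy j hj) (by positivity)) (hw1 j hj) (by positivity)
    have n4 : ‖w i * w j * x i * -(w i * y j - y j * w i) * w j‖ ≤ 1 * 1 * C * ε * 1 :=
      mle (mle (mle (mle (hw1 i hi) (hw1 j hj) zero_le_one) (hx i hi) (by positivity))
        (by rw [norm_neg]; exact hcy j hj i hi) (by positivity)) (hw1 j hj) (by positivity)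
    refine (norm_add_le_of_le (norm_add_le_of_le (norm_sub_le_of_le ((norm_neg _).trans_le n1) n2)
      n3) n4).trans ?_
    linarith
  rw [e1, e2, ← Finset.sum_sub_distrib, ← sub_add_cancel (∑ p ∈ s ×ˢ s, (_ - _))
    (∑ p ∈ s ×ˢ s, (w p.1 * w p.2) * z p * (w p.1 * w p.2)), ← Finset.sum_sub_distrib, add_comm]
  refine norm_add_le_of_le e3 ((norm_sum_le_of_le _ e4).trans ?_)
  rw [Finset.sum_const, Finset.card_product, nsmul_eq_mul]
  push_cast
  rw [sq]

/-- The `k`-th element of the piecewise linear partition of unity of mesh `1 / n` on `[0, 1]`. -/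
def hat (n k : ℕ) (x : ℝ) : ℝ := max 0 (min 1 (n * x - k + 1)) - max 0 (min 1 (n * x - k))

theorem continuous_hat (n k : ℕ) : Continuous (hat n k) := by
  unfold hat
  fun_prop

theorem hat_nonneg (n k : ℕ) (x : ℝ) : 0 ≤ hat n k x :=
  sub_nonneg.2 (max_le_max le_rfl (min_le_min le_rfl (by linarith)))

theorem hat_le_one (n k : ℕ) (x : ℝ) : hat n k x ≤ 1 := by
  have h1 : max 0 (min 1 (n * x - k + 1)) ≤ 1 := max_le zero_le_one (min_le_left _ _)
  have h2 : 0 ≤ max 0 (min 1 (n * x - k)) := le_max_left _ _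
  unfold hat
  linarith

theorem abs_sub_lt_of_hat_ne_zero {n k : ℕ} {x : ℝ} (h : hat n k x ≠ 0) : |n * x - k| < 1 := by
  contrapose! h
  unfold hat
  rcases le_abs.1 h with h | h
  · rw [min_eq_left (by linarith), min_eq_left h, sub_self]
  · rw [min_eq_right (by linarith), min_eq_right (by linarith), max_eq_left (by linarith),
      max_eq_left (by linarith), sub_self]

theorem hat_one_of_lt {n k : ℕ} (h : k < n) : hat n k 1 = 0 := by
  by_contra hne
  have h1 := (abs_lt.1 (abs_sub_lt_of_hat_ne_zero hne)).2
  have h2 : (k : ℝ) + 1 ≤ n := by exact_mod_cast h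
  linarith

theorem hat_zero_of_ne {n k : ℕ} (h : k ≠ 0) : hat n k 0 = 0 := by
  by_contra hne
  have h1 := (abs_lt.1 (abs_sub_lt_of_hat_ne_zero hne)).1
  have h2 : (1 : ℝ) ≤ k := by exact_mod_cast Nat.one_le_iff_ne_zero.2 h
  linarith

theorem hat_zero_zero (n : ℕ) : hat n 0 0 = 1 := by
  simp [hat]

theorem sum_hat (n : ℕ) {x : ℝ} (h0 : 0 ≤ x) (h1 : x ≤ 1) :
    ∑ k ∈ Finset.range (n + 1), hat n k x = 1 := by
  have e : ∀ k : ℕ, hat n k x = max 0 (min 1 (n * x - k + 1)) -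
      max 0 (min 1 (n * x - (k + 1 : ℕ) + 1)) := fun k => by
    unfold hat
    push_cast
    congr 4
    ring
  rw [Finset.sum_congr rfl fun k _ => e k,
    Finset.sum_range_sub' (fun k : ℕ => max 0 (min 1 (n * x - k + 1)))]
  have h2 : (n : ℝ) * x ≤ n := mul_le_of_le_one_right (Nat.cast_nonneg n) h1
  have h3 : 0 ≤ (n : ℝ) * x := by positivity
  push_cast
  rw [min_eq_left (by linarith), max_eq_right zero_le_one, min_eq_right (by linarith),
    max_eq_left (by linarith), sub_zero]

/-- Linear interpolation weights. -/
def lerpWeight (m : ℕ) (t : NNReal) : ℝ := max 0 (1 - |(t : ℝ) - m|)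

theorem lerpWeight_nonneg (m : ℕ) (t : NNReal) : 0 ≤ lerpWeight m t := le_max_left _ _

theorem continuous_lerpWeight (m : ℕ) : Continuous (lerpWeight m) := by
  unfold lerpWeight
  fun_prop

theorem lerpWeight_le_one (m : ℕ) (t : NNReal) : lerpWeight m t ≤ 1 :=
  max_le zero_le_one (by linarith [abs_nonneg ((t : ℝ) - m)])

theorem lerpWeight_eq_zero {m : ℕ} {t : NNReal} (h : 1 ≤ |(t : ℝ) - m|) : lerpWeight m t = 0 :=
  max_eq_left (by linarith)

theorem sum_lerpWeight {m : ℕ} {t : NNReal} (h0 : (m : ℝ) ≤ t) (h1 : (t : ℝ) ≤ m + 1) :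
    ∑ i ∈ {m, m + 1}, lerpWeight i t = 1 := by
  rw [Finset.sum_pair (by omega), lerpWeight, lerpWeight]
  push_cast
  rw [abs_of_nonneg (by linarith), abs_of_nonpos (by linarith), max_eq_right (by linarith),
    max_eq_right (by linarith)]
  ring

/-- Linear interpolation of a sequence of functions on `[0, ∞)`. -/
def lerp {V : Type*} [AddCommGroup V] [Module ℝ V] (a : ℕ → NNReal → V) (t : NNReal) : V :=
  ∑ i ∈ Finset.range (⌊(t : ℝ)⌋₊ + 2), lerpWeight i t • a i t

theorem lerp_eq_sum_range {V : Type*} [AddCommGroup V] [Module ℝ V] (a : ℕ → NNReal → V)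
    {t : NNReal} {n : ℕ} (h : (t : ℝ) < n) :
    lerp a t = ∑ i ∈ Finset.range (n + 1), lerpWeight i t • a i t := by
  refine Finset.sum_subset (Finset.range_subset_range.2 ?_) fun i _ hi => ?_
  · have := (Nat.floor_lt t.2).2 h
    simp only [NNReal.val_eq_coe] at this
    omega
  · rw [Finset.mem_range, not_lt] at hi
    have h1 := Nat.lt_floor_add_one (t : ℝ)
    have h2 : (⌊(t : ℝ)⌋₊ : ℝ) + 2 ≤ i := by exact_mod_cast hi
    rw [lerpWeight_eq_zero, zero_smul]
    rw [abs_of_nonpos (by linarith)]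
    linarith

theorem lerp_eq_sum_pair {V : Type*} [AddCommGroup V] [Module ℝ V] (a : ℕ → NNReal → V)
    {m : ℕ} {t : NNReal} (h0 : (m : ℝ) ≤ t) (h1 : (t : ℝ) ≤ m + 1) :
    lerp a t = ∑ i ∈ {m, m + 1}, lerpWeight i t • a i t := by
  rw [lerp_eq_sum_range a (n := m + 2) (by push_cast; linarith)]
  refine (Finset.sum_subset (fun i hi => ?_) fun i _ hi => ?_).symm
  · simp only [Finset.mem_insert, Finset.mem_singleton] at hi
    rw [Finset.mem_range]
    omega
  · rw [lerpWeight_eq_zero, zero_smul]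
    simp only [Finset.mem_insert, Finset.mem_singleton, not_or] at hi
    rcases Nat.lt_or_ge i m with h | h
    · have : (i : ℝ) + 1 ≤ m := by exact_mod_cast h
      exact le_abs.2 (Or.inl (by linarith))
    · have : (m : ℝ) + 2 ≤ i := by exact_mod_cast (by omega : m + 2 ≤ i)
      exact le_abs.2 (Or.inr (by linarith))

theorem continuous_lerp {V : Type*} [NormedAddCommGroup V] [NormedSpace ℝ V]
    {a : ℕ → NNReal → V} (ha : ∀ i, Continuous (a i)) : Continuous (lerp a) := by
  rw [continuous_iff_continuousAt]
  intro t
  obtain ⟨n, hn⟩ := exists_nat_gt (t : ℝ)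
  have h1 : ∀ᶠ s : NNReal in 𝓝 t, (s : ℝ) < n :=
    NNReal.continuous_coe.continuousAt.eventually_lt_const hn
  have h2 : Continuous fun s : NNReal => ∑ i ∈ Finset.range (n + 1), lerpWeight i s • a i s :=
    continuous_finsetSum _ fun i _ => (continuous_lerpWeight i).smul (ha i)
  refine h2.continuousAt.congr ?_
  filter_upwards [h1] with s hs using (lerp_eq_sum_range a hs).symm

/-- The `k`-th square root of the partition of unity, evaluated at `a`. -/
def hatCut {A : Type*} [CStarAlgebra A] (n k : ℕ) (a : A) : A := cfc (fun x => √(hat n k x)) a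

theorem continuous_sqrt_hat (n k : ℕ) : Continuous fun x => √(hat n k x) :=
  (continuous_hat n k).sqrt

section hatCut
variable {A : Type*} [CStarAlgebra A]

theorem isSelfAdjoint_hatCut (n k : ℕ) (a : A) : IsSelfAdjoint (hatCut n k a) := cfc_predicate _ a

theorem hatCut_commute (n k n' k' : ℕ) (a : A) : Commute (hatCut n k a) (hatCut n' k' a) :=
  cfc_commute_cfc _ _ a

theorem norm_hatCut_le (n k : ℕ) (a : A) : ‖hatCut n k a‖ ≤ 1 := by
  refine norm_cfc_le zero_le_one fun x _ => ?_
  rw [Real.norm_of_nonneg (Real.sqrt_nonneg _)]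
  exact Real.sqrt_le_one.2 (hat_le_one n k x)

theorem sum_hatCut_mul_self (n : ℕ) {a : A} (ha : IsPosContraction a) :
    ∑ k ∈ Finset.range (n + 1), hatCut n k a * hatCut n k a = 1 := by
  have hsa := ha.isSelfAdjoint
  have e : ∀ k, hatCut n k a * hatCut n k a = cfc (hat n k) a := fun k => by
    rw [hatCut, ← cfc_mul _ _ a (continuous_sqrt_hat n k).continuousOn
      (continuous_sqrt_hat n k).continuousOn]
    exact cfc_congr fun x _ => Real.mul_self_sqrt (hat_nonneg n k x)
  rw [Finset.sum_congr rfl fun k _ => e k,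
    ← cfc_sum _ a _ fun k _ => (continuous_hat n k).continuousOn, ← cfc_one ℝ a]
  refine cfc_congr fun x hx => ?_
  have := ha.spectrum_subset hx
  simpa using sum_hat n this.1 this.2

theorem hatCut_mul_hatCut_eq_zero {n k n' k' : ℕ} {a : A} (ha : IsPosContraction a)
    (h : ∀ x ∈ Set.Icc (0 : ℝ) 1, hat n k x = 0 ∨ hat n' k' x = 0) :
    hatCut n k a * hatCut n' k' a = 0 := by
  have hsa := ha.isSelfAdjoint
  rw [hatCut, hatCut, ← cfc_mul _ _ a (continuous_sqrt_hat n k).continuousOn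
      (continuous_sqrt_hat n' k').continuousOn, ← cfc_zero ℝ a]
  refine cfc_congr fun x hx => ?_
  rcases h x (ha.spectrum_subset hx) with h | h <;> simp [h]

theorem continuous_hatCut {T : Type*} [TopologicalSpace T] (n k : ℕ) {a : T → A}
    (ha : Continuous a) (h : ∀ t, IsPosContraction (a t)) : Continuous fun t => hatCut n k (a t) :=
  Continuous.cfc' isCompact_Icc _ ha (fun t => (h t).spectrum_subset)
    (continuous_sqrt_hat n k).continuousOn fun t => (h t).isSelfAdjoint

theorem hatCut_zero_zero [Nontrivial A] (n : ℕ) : hatCut n 0 (0 : A) = 1 := by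
  have : (0 : A) = algebraMap ℝ A 0 := by simp
  rw [hatCut, this, cfc_algebraMap, hat_zero_zero]
  simp

theorem hatCut_zero_of_ne [Nontrivial A] (n : ℕ) {k : ℕ} (hk : k ≠ 0) : hatCut n k (0 : A) = 0 := by
  have : (0 : A) = algebraMap ℝ A 0 := by simp
  rw [hatCut, this, cfc_algebraMap, hat_zero_of_ne hk]
  simp

theorem map_hatCut {A' : Type*} [CStarAlgebra A'] (χ : A →⋆ₐ[ℂ] A') (n k : ℕ) {a : A}
    (ha : IsSelfAdjoint a) : χ (hatCut n k a) = hatCut n k (χ a) := by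
  have hχ : Continuous χ := continuous_starHom (χ : A →⋆ₙₐ[ℂ] A')
  exact StarAlgHomClass.map_cfc (R := ℝ) (S := ℂ) χ _ a (continuous_sqrt_hat n k).continuousOn hχ

end hatCut

section smear
variable {A E : Type*} [CStarAlgebra A] [NonUnitalCStarAlgebra E]
  (j : E →⋆ₙₐ[ℂ] A) (ρ : ℝ → E →⋆ₙₐ[ℂ] E)

/-- Averaging of the path `ρ` by the partition of unity at `a`. -/
def hatConj (n : ℕ) (a : A) (e : E) : A :=
  ∑ k ∈ Finset.range (n + 1), hatCut n k a * j (ρ (1 - k / n) e) * hatCut n k a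

/-- Interpolation in `t` of the averages at different meshes. -/
def smear (n : ℕ → ℕ) (t : NNReal) (a : A) (e : E) : A :=
  lerp (fun i _ => hatConj j ρ (n i) a e) t

/-- The index set of the terms which contribute to `smear` at `t ∈ [m, m + 1]`. -/
def smearIndex (n : ℕ → ℕ) (m : ℕ) : Finset (Σ _ : ℕ, ℕ) :=
  Finset.sigma {m, m + 1} fun i => Finset.range (n i + 1)

/-- The weights which contribute to `smear`. -/
def smearWeight (n : ℕ → ℕ) (t : NNReal) (a : A) (p : Σ _ : ℕ, ℕ) : A :=
  √(lerpWeight p.1 t) • hatCut (n p.1) p.2 a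

theorem card_smearIndex (n : ℕ → ℕ) (m : ℕ) :
    (smearIndex n m).card = n m + n (m + 1) + 2 := by
  rw [smearIndex, Finset.card_sigma, Finset.sum_pair (by omega)]
  simp only [Finset.card_range]
  omega

theorem isSelfAdjoint_smearWeight (n : ℕ → ℕ) (t : NNReal) (a : A) (p : Σ _ : ℕ, ℕ) :
    IsSelfAdjoint (smearWeight n t a p) :=
  (IsSelfAdjoint.all _).smul (isSelfAdjoint_hatCut _ _ a)

theorem norm_sqrt_lerpWeight_le (m : ℕ) (t : NNReal) : ‖√(lerpWeight m t)‖ ≤ 1 := by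
  rw [Real.norm_of_nonneg (Real.sqrt_nonneg _)]
  exact Real.sqrt_le_one.2 (lerpWeight_le_one _ t)

theorem norm_smearWeight_le (n : ℕ → ℕ) (t : NNReal) (a : A) (p : Σ _ : ℕ, ℕ) :
    ‖smearWeight n t a p‖ ≤ 1 :=
  (norm_smul_le _ _).trans (mul_le_one₀ (norm_sqrt_lerpWeight_le _ t) (norm_nonneg _)
    (norm_hatCut_le _ _ a))

theorem smearWeight_conj (n : ℕ → ℕ) (t : NNReal) (a z : A) (p : Σ _ : ℕ, ℕ) :
    smearWeight n t a p * z * smearWeight n t a p =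
      lerpWeight p.1 t • (hatCut (n p.1) p.2 a * z * hatCut (n p.1) p.2 a) := by
  rw [smearWeight, smul_mul_assoc, smul_mul_assoc, mul_smul_comm, smul_smul,
    Real.mul_self_sqrt (lerpWeight_nonneg _ t)]

theorem sum_smearWeight_mul_self {m : ℕ} {t : NNReal} (h0 : (m : ℝ) ≤ t) (h1 : (t : ℝ) ≤ m + 1)
    (n : ℕ → ℕ) {a : A} (ha : IsPosContraction a) :
    ∑ p ∈ smearIndex n m, smearWeight n t a p * smearWeight n t a p = 1 := by
  have e : ∀ p, smearWeight n t a p * smearWeight n t a p =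
      lerpWeight p.1 t • (hatCut (n p.1) p.2 a * hatCut (n p.1) p.2 a) := fun p => by
    simpa using smearWeight_conj n t a 1 p
  rw [Finset.sum_congr rfl fun p _ => e p, smearIndex, Finset.sum_sigma]
  simp_rw [← Finset.smul_sum, sum_hatCut_mul_self _ ha]
  rw [← Finset.sum_smul, sum_lerpWeight h0 h1, one_smul]

theorem smear_eq_sum {m : ℕ} {t : NNReal} (h0 : (m : ℝ) ≤ t) (h1 : (t : ℝ) ≤ m + 1)
    (n : ℕ → ℕ) (a : A) (e : E) :
    smear j ρ n t a e = ∑ p ∈ smearIndex n m,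
      smearWeight n t a p * j (ρ (1 - p.2 / n p.1) e) * smearWeight n t a p := by
  rw [smear, lerp_eq_sum_pair _ h0 h1, smearIndex, Finset.sum_sigma]
  refine Finset.sum_congr rfl fun i _ => ?_
  rw [hatConj, Finset.smul_sum]
  exact Finset.sum_congr rfl fun k _ => (smearWeight_conj n t a _ ⟨i, k⟩).symm

end smear

section smearMap
variable {A E : Type*} [CStarAlgebra A] [NonUnitalCStarAlgebra E]
  (j : E →⋆ₙₐ[ℂ] A) (ρ : ℝ → E →⋆ₙₐ[ℂ] E)

theorem exists_nat_le_le (t : NNReal) : ∃ m : ℕ, (m : ℝ) ≤ t ∧ (t : ℝ) ≤ m + 1 :=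
  ⟨⌊(t : ℝ)⌋₊, Nat.floor_le t.2, (Nat.lt_floor_add_one (t : ℝ)).le⟩

theorem norm_smear_le [Nontrivial A] (n : ℕ → ℕ) (t : NNReal) {a : A} (ha : IsPosContraction a)
    (e : E) : ‖smear j ρ n t a e‖ ≤ 4 * ‖e‖ := by
  obtain ⟨m, h0, h1⟩ := exists_nat_le_le t
  rw [smear_eq_sum j ρ h0 h1]
  refine norm_sum_conjugate_le _ _ _ (fun p _ => isSelfAdjoint_smearWeight n t a p) ?_
    (norm_nonneg _) fun p _ => ?_
  · rw [sum_smearWeight_mul_self h0 h1 n ha, CStarRing.norm_one]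
  · exact (NonUnitalStarAlgHom.norm_apply_le j _).trans (NonUnitalStarAlgHom.norm_apply_le _ e)

theorem smear_add (n : ℕ → ℕ) (t : NNReal) (a : A) (e e' : E) :
    smear j ρ n t a (e + e') = smear j ρ n t a e + smear j ρ n t a e' := by
  obtain ⟨m, h0, h1⟩ := exists_nat_le_le t
  simp only [smear_eq_sum j ρ h0 h1, map_add, mul_add, add_mul, Finset.sum_add_distrib]

theorem smear_smul (n : ℕ → ℕ) (t : NNReal) (a : A) (c : ℂ) (e : E) :
    smear j ρ n t a (c • e) = c • smear j ρ n t a e := by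
  obtain ⟨m, h0, h1⟩ := exists_nat_le_le t
  simp only [smear_eq_sum j ρ h0 h1, map_smul, mul_smul_comm, smul_mul_assoc, Finset.smul_sum]

theorem smear_star (n : ℕ → ℕ) (t : NNReal) (a : A) (e : E) :
    smear j ρ n t a (star e) = star (smear j ρ n t a e) := by
  obtain ⟨m, h0, h1⟩ := exists_nat_le_le t
  simp only [smear_eq_sum j ρ h0 h1, map_star, star_sum, star_mul,
    (isSelfAdjoint_smearWeight n t a _).star_eq, mul_assoc]

theorem map_smear_eq_zero {A' : Type*} [CStarAlgebra A'] (χ : A →⋆ₐ[ℂ] A')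
    (hχ : ∀ e, χ (j e) = 0) (n : ℕ → ℕ) (t : NNReal) (a : A) (e : E) :
    χ (smear j ρ n t a e) = 0 := by
  obtain ⟨m, h0, h1⟩ := exists_nat_le_le t
  simp [smear_eq_sum j ρ h0 h1, map_sum, hχ]

theorem map_smear {A' : Type*} [CStarAlgebra A'] [Nontrivial A'] (χ : A →⋆ₐ[ℂ] A')
    (hρ : ∀ e, ρ 1 e = e) (n : ℕ → ℕ) (t : NNReal) {a : A} (ha : IsPosContraction a)
    (hχa : χ a = 0) (e : E) :
    χ (smear j ρ n t a e) = χ (j e) := by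
  have hsa := ha.isSelfAdjoint
  have h2 : ∀ n, χ (hatConj j ρ n a e) = χ (j e) := fun n => by
    rw [hatConj, map_sum, Finset.sum_eq_single 0]
    · rw [map_mul, map_mul, map_hatCut χ n 0 hsa, hχa, hatCut_zero_zero]
      simp [hρ]
    · intro k _ hk
      rw [map_mul, map_hatCut χ n k hsa, hχa, hatCut_zero_of_ne n hk, mul_zero]
    · simp
  have hsm : ∀ (c : ℝ) (z : A), χ (c • z) = c • χ z := fun c z => map_smul χ (c : ℂ) z
  obtain ⟨m, h0, h1⟩ := exists_nat_le_le t
  rw [smear, lerp_eq_sum_pair _ h0 h1, map_sum]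
  simp_rw [hsm, h2]
  rw [← Finset.sum_smul, sum_lerpWeight h0 h1, one_smul]

theorem continuous_smear (n : ℕ → ℕ) {a : NNReal → A} (hac : Continuous a)
    (ha : ∀ t, IsPosContraction (a t)) {z : NNReal → E} (hz : Continuous z) :
    Continuous fun t => smear j ρ n t (a t) (z t) := by
  refine continuous_lerp (a := fun i t => hatConj j ρ (n i) (a t) (z t)) fun i => ?_
  refine continuous_finsetSum _ fun k _ => ?_
  have h1 := continuous_hatCut (n i) k hac ha
  exact (h1.mul ((continuous_starHom j).comp ((continuous_starHom (ρ _)).comp hz))).mul h1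

theorem norm_smear_le_of_norm_hatCut_mul_le {n : ℕ → ℕ} {m : ℕ} {t : NNReal} (h0 : (m : ℝ) ≤ t)
    (h1 : (t : ℝ) ≤ m + 1) (hn : ∀ i, n i ≠ 0) (a : A) (y : E) {ε : ℝ}
    (h : ∀ p ∈ smearIndex n m, p.2 < n p.1 →
      ‖hatCut (n p.1) p.2 a * j (ρ (1 - p.2 / n p.1) y)‖ ≤ ε) :
    ‖smear j ρ n t a y‖ ≤ (n m + n (m + 1) + 2 : ℕ) * ε + ‖ρ 0 y‖ := by
  have hmem : ∀ i ∈ ({m, m + 1} : Finset ℕ), ∀ k ≤ n i,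
      (⟨i, k⟩ : Σ _ : ℕ, ℕ) ∈ smearIndex n m := fun i hi k hk =>
    Finset.mem_sigma.2 ⟨hi, Finset.mem_range.2 (Nat.lt_succ_of_le hk)⟩
  have hε : 0 ≤ ε := (norm_nonneg _).trans
    (h ⟨m, 0⟩ (hmem m (by simp) 0 (Nat.zero_le _)) (Nat.pos_of_ne_zero (hn m)))
  have hle : ∀ i ∈ ({m, m + 1} : Finset ℕ), (n i : ℝ) ≤ (n m + n (m + 1) + 2 : ℕ) := by
    intro i hi
    simp only [Finset.mem_insert, Finset.mem_singleton] at hi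
    norm_cast
    rcases hi with rfl | rfl <;> omega
  have h2 : ∀ i ∈ ({m, m + 1} : Finset ℕ),
      ‖hatConj j ρ (n i) a y‖ ≤ (n m + n (m + 1) + 2 : ℕ) * ε + ‖ρ 0 y‖ := by
    intro i hi
    rw [hatConj, Finset.sum_range_succ]
    refine norm_add_le_of_le ((norm_sum_le_of_le _ (n := fun _ => ε) fun k hk => ?_).trans ?_) ?_
    · have hk' := Finset.mem_range.1 hk
      exact (norm_mul_le _ _).trans (mul_le_of_le_one_right (norm_nonneg _)
        (norm_hatCut_le _ _ a) |>.trans (h ⟨i, k⟩ (hmem i hi k hk'.le) hk'))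
    · rw [Finset.sum_const, Finset.card_range, nsmul_eq_mul]
      exact mul_le_mul_of_nonneg_right (hle i hi) hε
    · rw [div_self (Nat.cast_ne_zero.2 (hn i)), sub_self]
      refine (norm_mul_le _ _).trans ((mul_le_of_le_one_right (norm_nonneg _)
        (norm_hatCut_le _ _ a)).trans ((norm_mul_le _ _).trans
          ((mul_le_of_le_one_left (norm_nonneg _) (norm_hatCut_le _ _ a)).trans ?_)))
      exact NonUnitalStarAlgHom.norm_apply_le j _
  rw [smear, lerp_eq_sum_pair _ h0 h1]
  refine (norm_sum_le_of_le _ (n := fun i => lerpWeight i t *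
    ((n m + n (m + 1) + 2 : ℕ) * ε + ‖ρ 0 y‖)) fun i hi => ?_).trans ?_
  · rw [norm_smul, Real.norm_of_nonneg (lerpWeight_nonneg i t)]
    exact mul_le_mul_of_nonneg_left (h2 i hi) (lerpWeight_nonneg i t)
  · rw [← Finset.sum_mul, sum_lerpWeight h0 h1, one_mul]

theorem norm_smear_mul_sub_le [Nontrivial A] {n : ℕ → ℕ} {m : ℕ} {t : NNReal} (h0 : (m : ℝ) ≤ t)
    (h1 : (t : ℝ) ≤ m + 1) (hn : ∀ i, n i ≠ 0) {a : A} (ha : IsPosContraction a) {e e' : E}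
    {C ω ε : ℝ} (he : ‖e‖ ≤ C) (he' : ‖e'‖ ≤ C)
    (hω : ∀ i ∈ ({m, m + 1} : Finset ℕ), ∀ r ∈ Set.Icc (0 : ℝ) 1, ∀ r' ∈ Set.Icc (0 : ℝ) 1,
      |r - r'| ≤ 1 / n i → ‖ρ r e' - ρ r' e'‖ ≤ ω)
    (hc : ∀ p ∈ smearIndex n m, ∀ p' ∈ smearIndex n m,
      ‖hatCut (n p'.1) p'.2 a * j (ρ (1 - p.2 / n p.1) e) -
        j (ρ (1 - p.2 / n p.1) e) * hatCut (n p'.1) p'.2 a‖ ≤ ε)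
    (hc' : ∀ p ∈ smearIndex n m, ∀ p' ∈ smearIndex n m,
      ‖hatCut (n p'.1) p'.2 a * j (ρ (1 - p.2 / n p.1) e') -
        j (ρ (1 - p.2 / n p.1) e') * hatCut (n p'.1) p'.2 a‖ ≤ ε) :
    ‖smear j ρ n t a (e * e') - smear j ρ n t a e * smear j ρ n t a e'‖ ≤
      4 * (C * (2 * ω)) + ((n m + n (m + 1) + 2 : ℕ) : ℝ) ^ 2 * (4 * C * ε) := by
  have hC : 0 ≤ C := (norm_nonneg _).trans he
  have hω0 : 0 ≤ ω := (norm_nonneg _).trans (hω m (by simp) 0 (by simp) 0 (by simp) (by simp))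
  have hcomm : ∀ p z ε, ‖hatCut (n p.1) p.2 a * z - z * hatCut (n p.1) p.2 a‖ ≤ ε →
      ‖smearWeight n t a p * z - z * smearWeight n t a p‖ ≤ ε := fun p z ε h => by
    rw [smearWeight, smul_mul_assoc, mul_smul_comm, ← smul_sub]
    exact (norm_smul_le _ _).trans ((mul_le_of_le_one_left (norm_nonneg _)
      (norm_sqrt_lerpWeight_le _ t)).trans h)
  simp only [smear_eq_sum j ρ h0 h1, map_mul, ← card_smearIndex n m]
  refine norm_sum_conjugate_mul_sub_le _ _ _ _ (fun p _ => isSelfAdjoint_smearWeight n t a p)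
    (fun p _ p' _ => ((hatCut_commute _ _ _ _ a).smul_left _).smul_right _)
    (fun p _ => norm_smearWeight_le n t a p) (sum_smearWeight_mul_self h0 h1 n ha) hC
    (by positivity)
    (fun p _ => (NonUnitalStarAlgHom.norm_apply_le j _).trans
      ((NonUnitalStarAlgHom.norm_apply_le _ _).trans he))
    (fun p _ => (NonUnitalStarAlgHom.norm_apply_le j _).trans
      ((NonUnitalStarAlgHom.norm_apply_le _ _).trans he'))
    (fun p hp p' hp' => hcomm _ _ _ (hc p hp p' hp'))
    (fun p hp p' hp' => hcomm _ _ _ (hc' p hp p' hp')) ?_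
  rintro ⟨i, k⟩ hp ⟨i', k'⟩ hp'
  simp only [smearIndex, Finset.mem_sigma, Finset.mem_range] at hp hp'
  by_cases hx : ∃ x ∈ Set.Icc (0 : ℝ) 1, hat (n i) k x ≠ 0 ∧ hat (n i') k' x ≠ 0
  · obtain ⟨x, hx, hx1, hx2⟩ := hx
    right
    have key : ∀ i ∈ ({m, m + 1} : Finset ℕ), ∀ k < n i + 1, hat (n i) k x ≠ 0 →
        ‖ρ (1 - k / n i) e' - ρ (1 - x) e'‖ ≤ ω := by
      intro i hi k hk h
      have hpos : (0 : ℝ) < n i := Nat.cast_pos.2 (Nat.pos_of_ne_zero (hn i))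
      have hk' : (k : ℝ) ≤ n i := by exact_mod_cast Nat.le_of_lt_succ hk
      refine hω i hi _ ⟨?_, ?_⟩ _ ⟨?_, ?_⟩ ?_
      · rw [sub_nonneg]
        exact div_le_one_of_le₀ hk' hpos.le
      · rw [sub_le_self_iff]
        positivity
      · linarith [hx.2]
      · linarith [hx.1]
      · have e : (1 : ℝ) - k / n i - (1 - x) = (n i * x - k) / n i := by
          field_simp
          ring
        rw [e, abs_div, abs_of_pos hpos]
        exact div_le_div_of_nonneg_right (abs_sub_lt_of_hat_ne_zero h).le hpos.le
    rw [← map_sub, ← sub_sub_sub_cancel_right _ _ (ρ (1 - x) e'), two_mul]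
    exact (NonUnitalStarAlgHom.norm_apply_le j _).trans
      (norm_sub_le_of_le (key i hp.1 k hp.2 hx1) (key i' hp'.1 k' hp'.2 hx2))
  · left
    push Not at hx
    rw [smearWeight, smearWeight, smul_mul_assoc, mul_smul_comm, hatCut_mul_hatCut_eq_zero ha,
      smul_zero, smul_zero]
    intro x hxI
    by_cases h : hat (n i) k x = 0
    · exact Or.inl h
    · exact Or.inr (hx x hxI h)
end smearMap

section smearedPath

open BoundedContinuousFunction

universe u v

section path
variable {E : Type u} {P : Type v} [NonUnitalCStarAlgebra E] [NonUnitalCStarAlgebra P]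

/-- Postcomposition of bounded continuous functions by a star homomorphism. -/
def starHomComp {T : Type*} [TopologicalSpace T] (q : E →⋆ₙₐ[ℂ] P) : (T →ᵇ E) →⋆ₙₐ[ℂ] (T →ᵇ P) where
  toFun z := BoundedContinuousFunction.ofNormedAddCommGroup (fun t => q (z t))
    ((continuous_starHom q).comp z.continuous) ‖z‖
    fun t => (NonUnitalStarAlgHom.norm_apply_le q _).trans (z.norm_coe_le_norm t)
  map_smul' c z := by ext t; exact map_smul q c (z t)
  map_zero' := by ext t; exact map_zero q
  map_add' z w := by ext t; exact map_add q (z t) (w t)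
  map_mul' z w := by ext t; exact map_mul q (z t) (w t)
  map_star' z := by ext t; exact map_star q (z t)

theorem continuous_path_apply {ρ : ℝ → E →⋆ₙₐ[ℂ] E} (hρc : ∀ e, Continuous fun r => ρ r e)
    {z : NNReal → E} (hz : Continuous z) :
    Continuous fun p : ℝ × NNReal => ρ p.1 (z p.2) := by
  have h : Continuous fun p : E × ℝ => ρ p.2 p.1 := by
    refine continuous_prod_of_continuous_lipschitzWith _ 1 hρc fun r => ?_
    refine LipschitzWith.of_dist_le_mul fun a b => ?_
    rw [dist_eq_norm, dist_eq_norm, ← map_sub, NNReal.coe_one, one_mul]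
    exact NonUnitalStarAlgHom.norm_apply_le _ _
  exact h.comp ((hz.comp continuous_snd).prodMk continuous_fst)

theorem exists_modulus {ρ : ℝ → E →⋆ₙₐ[ℂ] E} (hρc : ∀ e, Continuous fun r => ρ r e)
    {z : NNReal → E} (hz : Continuous z) (τ : NNReal) {ε : ℝ} (hε : 0 < ε) :
    ∃ δ > 0, ∀ t ≤ τ, ∀ r ∈ Set.Icc (0 : ℝ) 1, ∀ r' ∈ Set.Icc (0 : ℝ) 1, |r - r'| ≤ δ →
      ‖ρ r (z t) - ρ r' (z t)‖ ≤ ε := by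
  have hK : IsCompact (Set.Icc (0 : ℝ) 1 ×ˢ Set.Icc (0 : NNReal) τ) :=
    isCompact_Icc.prod isCompact_Icc
  have h := hK.uniformContinuousOn_of_continuous (continuous_path_apply hρc hz).continuousOn
  obtain ⟨δ, hδ, h⟩ := Metric.uniformContinuousOn_iff_le.1 h ε hε
  refine ⟨δ, hδ, fun t ht r hr r' hr' hrr => ?_⟩
  rw [← dist_eq_norm]
  refine h (r, t) ⟨hr, bot_le, ht⟩ (r', t) ⟨hr', bot_le, ht⟩ ?_
  rw [Prod.dist_eq, dist_self, Real.dist_eq]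
  exact max_le hrr hδ.le

theorem exists_mesh {ρ : ℝ → E →⋆ₙₐ[ℂ] E} (hρc : ∀ e, Continuous fun r => ρ r e)
    {x : ℕ → NNReal → E} (hx : ∀ i, Continuous (x i)) :
    ∃ n : ℕ → ℕ, (∀ m, n m ≠ 0) ∧ ∀ m : ℕ, ∀ i ≤ m, ∀ t : NNReal, (t : ℝ) ≤ m + 1 →
      ∀ r ∈ Set.Icc (0 : ℝ) 1, ∀ r' ∈ Set.Icc (0 : ℝ) 1, |r - r'| ≤ 1 / n m →
      ‖ρ r (x i t) - ρ r' (x i t)‖ ≤ 1 / (m + 1) := by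
  suffices h : ∀ m : ℕ, ∃ n : ℕ, n ≠ 0 ∧ ∀ i ≤ m, ∀ t : NNReal, (t : ℝ) ≤ m + 1 →
      ∀ r ∈ Set.Icc (0 : ℝ) 1, ∀ r' ∈ Set.Icc (0 : ℝ) 1, |r - r'| ≤ 1 / n →
      ‖ρ r (x i t) - ρ r' (x i t)‖ ≤ 1 / (m + 1) by
    choose n h1 h2 using h
    exact ⟨n, h1, h2⟩
  intro m
  have h : ∀ i, ∀ᶠ n : ℕ in atTop, ∀ t : NNReal, (t : ℝ) ≤ m + 1 →
      ∀ r ∈ Set.Icc (0 : ℝ) 1, ∀ r' ∈ Set.Icc (0 : ℝ) 1, |r - r'| ≤ 1 / n →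
      ‖ρ r (x i t) - ρ r' (x i t)‖ ≤ 1 / (m + 1) := fun i => by
    obtain ⟨δ, hδ, h⟩ := exists_modulus hρc (hx i) (m + 1) (ε := 1 / (m + 1)) (by positivity)
    filter_upwards [tendsto_one_div_atTop_nhds_zero_nat.eventually (eventually_le_nhds hδ)]
      with n hn t ht r hr r' hr' hrr
    exact h t (by exact_mod_cast ht) r hr r' hr' (hrr.trans hn)
  obtain ⟨n, hn, hn0⟩ := (((Set.finite_Iic m).eventually_all.2 fun i _ => h i).and
    (eventually_ne_atTop 0)).exists
  exact ⟨n, hn0, hn⟩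

end path

theorem exists_hatCut_tolerance (n : ℕ → ℕ) (m : ℕ) {ε : ℝ} (hε : 0 < ε) (C : ℝ) :
    ∃ δ > 0, ∀ (A : Type u) [CStarAlgebra A] [Nontrivial A] (a z : A), IsPosContraction a →
      ‖z‖ ≤ C → ∀ p ∈ smearIndex n m,
      (‖a * z - z * a‖ ≤ δ →
        ‖hatCut (n p.1) p.2 a * z - z * hatCut (n p.1) p.2 a‖ ≤ ε) ∧
      (p.2 < n p.1 → ‖z - a * z‖ ≤ δ → ‖hatCut (n p.1) p.2 a * z‖ ≤ ε) := by
  choose δ hδ h using fun p : Σ _ : ℕ, ℕ =>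
    exists_cfc_almost_commute.{u} (continuous_sqrt_hat (n p.1) p.2) hε C
  have h1 : ∀ p, ∀ᶠ d in 𝓝[>] (0 : ℝ), d ≤ δ p := fun p =>
    nhdsWithin_le_nhds (eventually_le_nhds (hδ p))
  obtain ⟨d, hd, hd0⟩ := (((smearIndex n m).eventually_all.2 fun p _ => h1 p).and
    self_mem_nhdsWithin).exists
  refine ⟨d, hd0, fun A _ _ a z ha hz p hp => ?_⟩
  obtain ⟨h2, h3⟩ := h p A a z ha hz
  exact ⟨fun h => h2 (h.trans (hd p hp)), fun hlt h => h3 (by simp [hat_one_of_lt hlt])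
    (h.trans (hd p hp))⟩

end smearedPath

section quasicentral

open BoundedContinuousFunction

universe u v

section quasicentralMain
variable {E : Type u} {P : Type v} [NonUnitalCStarAlgebra E] [NonUnitalCStarAlgebra P]

theorem exists_quasicentral_seq (q : E →⋆ₙₐ[ℂ] P) {ρ : ℝ → E →⋆ₙₐ[ℂ] E}
    (hρq : ∀ r e, q e = 0 → q (ρ r e) = 0) (n : ℕ → ℕ) {δ : ℕ → ℝ} (hδ : ∀ m, 0 < δ m)
    (x y : ℕ → (NNReal →ᵇ E)) (hy : ∀ i t, q (y i t) = 0) :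
    ∃ U : ℕ → (NNReal →ᵇ E), (∀ j t, IsPosContraction (U j t)) ∧ (∀ j t, q (U j t) = 0) ∧
      ∀ m, ∀ j ∈ ({m, m + 1} : Finset ℕ), ∀ i ≤ m, ∀ p ∈ smearIndex n m, ∀ t,
        ‖U j t * ρ (1 - p.2 / n p.1) (x i t) - ρ (1 - p.2 / n p.1) (x i t) * U j t‖ ≤ δ m ∧
        ‖ρ (1 - p.2 / n p.1) (y i t) - U j t * ρ (1 - p.2 / n p.1) (y i t)‖ ≤ δ m := by
  classical
  let G : ℕ → Finset (ℕ × Σ _ : ℕ, ℕ) := fun j =>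
    Finset.range (j + 1) ×ˢ (smearIndex n j ∪ smearIndex n (j - 1))
  let w : (ℕ → (NNReal →ᵇ E)) → (ℕ × Σ _ : ℕ, ℕ) → (NNReal →ᵇ E) := fun x g =>
    starHomComp (ρ (1 - g.2.2 / n g.2.1)) (x g.1)
  have h := fun j => exists_quasicentral (starHomComp (T := NNReal) q) ((G j).image (w x))
    ((G j).image (w y)) (by
      simp only [Finset.mem_image, forall_exists_index, and_imp]
      rintro _ g - rfl
      ext t
      exact hρq _ _ (hy _ t)) (lt_min (hδ j) (hδ (j - 1)))
  choose v h1 h2 h3 h4 using h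
  refine ⟨fun j => star (v j) * v j, fun j t => ⟨⟨v j t, rfl⟩, ?_⟩, fun j t => ?_, ?_⟩
  · exact ((star (v j) * v j).norm_coe_le_norm t).trans (h2 j)
  · have : q (v j t) = 0 := congrArg (fun f => f t) (h1 j)
    change q (star (v j t) * v j t) = 0
    rw [map_mul, this, mul_zero]
  · intro m j hj i hi p hp t
    simp only [Finset.mem_insert, Finset.mem_singleton] at hj
    have hg : (i, p) ∈ G j := by
      refine Finset.mem_product.2 ⟨Finset.mem_range.2 ?_, Finset.mem_union.2 ?_⟩
      · change i < j + 1
        omega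
      · rcases hj with rfl | rfl
        · exact Or.inl hp
        · exact Or.inr hp
    have hm : min (δ j) (δ (j - 1)) ≤ δ m := by
      rcases hj with rfl | rfl
      · exact min_le_left _ _
      · exact min_le_right _ _
    exact ⟨((BoundedContinuousFunction.norm_coe_le_norm (star (v j) * v j * w x (i, p) -
        w x (i, p) * (star (v j) * v j)) t).trans (h3 j _ (Finset.mem_image_of_mem _ hg))).trans hm,
      ((BoundedContinuousFunction.norm_coe_le_norm (w y (i, p) -
        star (v j) * v j * w y (i, p)) t).trans (h4 j _ (Finset.mem_image_of_mem _ hg))).trans hm⟩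

theorem exists_quasicentral_path (q : E →⋆ₙₐ[ℂ] P) {ρ : ℝ → E →⋆ₙₐ[ℂ] E}
    (hρq : ∀ r e, q e = 0 → q (ρ r e) = 0) (n : ℕ → ℕ) {δ : ℕ → ℝ} (hδ : ∀ m, 0 < δ m)
    (x y : ℕ → (NNReal →ᵇ E)) (hy : ∀ i t, q (y i t) = 0) :
    ∃ u : NNReal → E, Continuous u ∧ (∀ t, IsPosContraction (u t)) ∧ (∀ t, q (u t) = 0) ∧
      ∀ (m : ℕ) (t : NNReal), (m : ℝ) ≤ t → (t : ℝ) ≤ m + 1 → ∀ i ≤ m, ∀ p ∈ smearIndex n m,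
        ‖u t * ρ (1 - p.2 / n p.1) (x i t) - ρ (1 - p.2 / n p.1) (x i t) * u t‖ ≤ δ m ∧
        ‖ρ (1 - p.2 / n p.1) (y i t) - u t * ρ (1 - p.2 / n p.1) (y i t)‖ ≤ δ m := by
  obtain ⟨U, h1, h2, h3⟩ := exists_quasicentral_seq q hρq n hδ x y hy
  have hsm : ∀ (c : ℝ) (z : E), q (c • z) = c • q z := fun c z => map_smul q (c : ℂ) z
  have key : ∀ (m : ℕ) (t : NNReal), (m : ℝ) ≤ t → (t : ℝ) ≤ m + 1 → ∀ (f : E → E),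
      (∀ z w, f (z + w) = f z + f w) → (∀ (c : ℝ) z, f (c • z) = c • f z) → ∀ (g : E) (d : ℝ),
      (∀ j ∈ ({m, m + 1} : Finset ℕ), ‖g - f (U j t)‖ ≤ d) →
      ‖g - f (lerp (fun j t => U j t) t)‖ ≤ d := by
    intro m t h0 h1 f hf hf' g d h
    have hw := sum_lerpWeight h0 h1
    rw [lerp_eq_sum_pair _ h0 h1]
    rw [Finset.sum_pair (by omega)] at hw ⊢
    have e : g - f (lerpWeight m t • U m t + lerpWeight (m + 1) t • U (m + 1) t) =
        lerpWeight m t • (g - f (U m t)) + lerpWeight (m + 1) t • (g - f (U (m + 1) t)) := by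
      nth_rewrite 1 [← one_smul ℝ g]
      rw [← hw, hf, hf', hf', add_smul, smul_sub, smul_sub]
      abel
    rw [e]
    refine (norm_add_le_of_le (norm_smul_le _ _) (norm_smul_le _ _)).trans ?_
    rw [Real.norm_of_nonneg (lerpWeight_nonneg _ _), Real.norm_of_nonneg (lerpWeight_nonneg _ _)]
    calc _ ≤ lerpWeight m t * d + lerpWeight (m + 1) t * d :=
          add_le_add (mul_le_mul_of_nonneg_left (h m (by simp)) (lerpWeight_nonneg _ _))
            (mul_le_mul_of_nonneg_left (h (m + 1) (by simp)) (lerpWeight_nonneg _ _))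
      _ = d := by rw [← add_mul, hw, one_mul]
  refine ⟨lerp fun j t => U j t, continuous_lerp fun j => (U j).continuous, fun t => ?_,
    fun t => ?_, fun m t h0 h1 i hi p hp => ⟨?_, ?_⟩⟩
  · obtain ⟨m, h0, h1'⟩ := exists_nat_le_le t
    have hw := sum_lerpWeight h0 h1'
    rw [lerp_eq_sum_pair _ h0 h1']
    rw [Finset.sum_pair (by omega)] at hw ⊢
    exact (h1 m t).combo (h1 (m + 1) t) (lerpWeight_nonneg _ _) (lerpWeight_nonneg _ _) hw
  · rw [lerp, map_sum]
    exact Finset.sum_eq_zero fun j _ => by rw [hsm, h2, smul_zero]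
  · have := key m t h0 h1 (fun z => ρ (1 - p.2 / n p.1) (x i t) * z - z * ρ (1 - p.2 / n p.1) (x i t))
      (fun z w => by simp only [mul_add, add_mul]; abel)
      (fun c z => by simp only [mul_smul_comm, smul_mul_assoc, smul_sub]) 0 (δ m)
      fun j hj => by simpa using (h3 m j hj i hi p hp t).1
    simpa using this
  · exact key m t h0 h1 (fun z => z * ρ (1 - p.2 / n p.1) (y i t)) (fun z w => add_mul _ _ _)
      (fun c z => smul_mul_assoc _ _ _) _ _ fun j hj => (h3 m j hj i hi p hp t).2

end quasicentralMain

end quasicentral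

section starLinear

open BoundedContinuousFunction

universe u v

/-- A family of uniformly bounded star-preserving linear maps over `P`, depending continuously on
the parameter. -/
structure IsStarLinearFamily {E P : Type*} [NonUnitalCStarAlgebra E] [NonUnitalCStarAlgebra P]
    (q : E →⋆ₙₐ[ℂ] P) (M : NNReal → E → E) : Prop where
  add : ∀ t e e', M t (e + e') = M t e + M t e'
  smul : ∀ t (c : ℂ) e, M t (c • e) = c • M t e
  star : ∀ t e, M t (star e) = star (M t e)
  norm_le : ∀ t e, ‖M t e‖ ≤ 4 * ‖e‖
  continuous : ∀ z : NNReal → E, Continuous z → Continuous fun t => M t (z t)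
  map : ∀ t e, q (M t e) = q e

section starLinearMain
variable {E : Type u} {P : Type v} [NonUnitalCStarAlgebra E] [NonUnitalCStarAlgebra P]

theorem IsStarLinearFamily.sub {q : E →⋆ₙₐ[ℂ] P} {M : NNReal → E → E}
    (hM : IsStarLinearFamily q M) (t : NNReal) (e e' : E) : M t (e - e') = M t e - M t e' := by
  rw [sub_eq_add_neg, hM.add, ← neg_one_smul ℂ e', hM.smul, neg_one_smul, sub_eq_add_neg]

theorem exists_smear (q : E →⋆ₙₐ[ℂ] P) {ρ : ℝ → E →⋆ₙₐ[ℂ] E} (hρ : ∀ e, ρ 1 e = e) (n : ℕ → ℕ)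
    {u : NNReal → E} (hu : Continuous u) (hu' : ∀ t, IsPosContraction (u t))
    (hqu : ∀ t, q (u t) = 0) :
    ∃ M : NNReal → E → E, IsStarLinearFamily q M ∧ ∀ t e, (M t e : Unitization ℂ E) =
      smear (Unitization.inrNonUnitalStarAlgHom ℂ E) ρ n t (u t : Unitization ℂ E) e := by
  let S : NNReal → E → Unitization ℂ E := fun t e =>
    smear (Unitization.inrNonUnitalStarAlgHom ℂ E) ρ n t (u t : Unitization ℂ E) e
  have hfst : ∀ z : Unitization ℂ E, Unitization.starLift (0 : E →⋆ₙₐ[ℂ] ℂ) z = z.fst :=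
    fun z => add_zero z.fst
  have hS : ∀ t e, ((S t e).snd : Unitization ℂ E) = S t e := fun t e => by
    have h : Unitization.starLift (0 : E →⋆ₙₐ[ℂ] ℂ) (S t e) = 0 :=
      map_smear_eq_zero _ ρ _ (fun e => hfst _) n t _ e
    rw [hfst] at h
    ext
    · simp [h]
    · simp
  have hinj : Function.Injective (Unitization.inr : E → Unitization ℂ E) :=
    Unitization.inr_injective
  refine ⟨fun t e => (S t e).snd, ⟨fun t e e' => ?_, fun t c e => ?_, fun t e => ?_,
    fun t e => ?_, fun z hz => ?_, fun t e => ?_⟩, hS⟩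
  · simp only [S, smear_add, Unitization.snd_add]
  · simp only [S, smear_smul, Unitization.snd_smul]
  · simp only [S, smear_star, Unitization.snd_star]
  · rw [← Unitization.norm_inr (𝕜 := ℂ), hS]
    exact norm_smear_le _ ρ n t (hu' t).inr e
  · rw [(Unitization.isometry_inr (𝕜 := ℂ) (A := E)).isEmbedding.continuous_iff]
    have : Continuous fun t => S t (z t) := continuous_smear _ ρ n
      ((Unitization.isometry_inr (𝕜 := ℂ) (A := E)).continuous.comp hu) (fun t => (hu' t).inr) hz
    exact this.congr fun t => (hS t (z t)).symm
  · have h : Unitization.starMap q (S t e) = Unitization.starMap q (e : Unitization ℂ E) :=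
      map_smear _ ρ _ hρ n t (hu' t).inr (by simp [hqu]) e
    rw [← hS, Unitization.starMap_inr, Unitization.starMap_inr] at h
    exact Unitization.inr_injective h

theorem exists_family_of_seq (q : E →⋆ₙₐ[ℂ] P) {ρ : ℝ → E →⋆ₙₐ[ℂ] E}
    (hρc : ∀ e, Continuous fun r => ρ r e) (hρ : ∀ e, ρ 1 e = e)
    (hρq : ∀ r e, q e = 0 → q (ρ r e) = 0) (x y : ℕ → (NNReal →ᵇ E)) (hy : ∀ i t, q (y i t) = 0) :
    ∃ M : NNReal → E → E, IsStarLinearFamily q M ∧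
      (∀ i i', Tendsto (fun t => ‖M t (x i t * x i' t) - M t (x i t) * M t (x i' t)‖)
        atTop (𝓝 0)) ∧
      ∀ i, Tendsto (fun t => ‖ρ 0 (y i t)‖) atTop (𝓝 0) →
        Tendsto (fun t => ‖M t (y i t)‖) atTop (𝓝 0) := by
  obtain ⟨n, hn, hmesh⟩ := exists_mesh hρc fun i => (x i).continuous
  let N : ℕ → ℝ := fun m => (n m + n (m + 1) + 2 : ℕ)
  have hN : ∀ m, 1 ≤ N m := fun m => by simp only [N]; norm_cast; omega
  have hε : ∀ m : ℕ, 0 < 1 / ((m + 1) * N m ^ 2) := fun m => by have := hN m; positivity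
  let C : ℕ → ℝ := fun m => ∑ i ∈ Finset.range (m + 1), (‖x i‖ + ‖y i‖)
  have hC : ∀ m, ∀ i ≤ m, ‖x i‖ + ‖y i‖ ≤ C m := fun m i hi =>
    Finset.single_le_sum (f := fun i => ‖x i‖ + ‖y i‖) (fun i _ => by positivity)
      (Finset.mem_range.2 (Nat.lt_succ_of_le hi))
  choose δ hδ htol using fun m => exists_hatCut_tolerance.{u} n m (hε m) (C m)
  obtain ⟨u, hu, hu', hqu, hq⟩ := exists_quasicentral_path q hρq n hδ x y hy
  obtain ⟨M, hM, hMS⟩ := exists_smear q hρ n hu hu' hqu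
  have hxn : ∀ i t, ‖x i t‖ ≤ ‖x i‖ := fun i t => (x i).norm_coe_le_norm t
  have hyn : ∀ i t, ‖y i t‖ ≤ ‖y i‖ := fun i t => (y i).norm_coe_le_norm t
  have hlim : ∀ c : ℝ, Tendsto (fun t : NNReal => c * (1 / (⌊(t : ℝ)⌋₊ + 1 : ℝ))) atTop (𝓝 0) := by
    intro c
    rw [← mul_zero c]
    exact (tendsto_one_div_add_atTop_nhds_zero_nat.comp
      ((tendsto_nat_floor_atTop (α := ℝ)).comp (NNReal.tendsto_coe_atTop.2 tendsto_id))).const_mul c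
  have hcomm : ∀ (m : ℕ) (t : NNReal), (m : ℝ) ≤ t → (t : ℝ) ≤ m + 1 → ∀ i ≤ m,
      ∀ p ∈ smearIndex n m, ∀ p' ∈ smearIndex n m,
      ‖hatCut (n p'.1) p'.2 (u t : Unitization ℂ E) *
          Unitization.inrNonUnitalStarAlgHom ℂ E (ρ (1 - p.2 / n p.1) (x i t)) -
        Unitization.inrNonUnitalStarAlgHom ℂ E (ρ (1 - p.2 / n p.1) (x i t)) *
          hatCut (n p'.1) p'.2 (u t : Unitization ℂ E)‖ ≤ 1 / ((m + 1) * N m ^ 2) := by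
    intro m t h0 h1 i hi p hp p' hp'
    refine (htol m _ _ _ (hu' t).inr ?_ p' hp').1 ?_
    · rw [Unitization.inrNonUnitalStarAlgHom_apply, Unitization.norm_inr]
      exact (NonUnitalStarAlgHom.norm_apply_le _ _).trans ((hxn i t).trans
        ((le_add_of_nonneg_right (norm_nonneg _)).trans (hC m i hi)))
    · rw [Unitization.inrNonUnitalStarAlgHom_apply, ← Unitization.inr_mul, ← Unitization.inr_mul,
        ← Unitization.inr_sub, Unitization.norm_inr]
      exact (hq m t h0 h1 i hi p hp).1
  refine ⟨M, hM, fun i i' => ?_, fun i hi => ?_⟩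
  · have hmax : ∀ᶠ t : NNReal in atTop, max i i' ≤ ⌊(t : ℝ)⌋₊ :=
      ((tendsto_nat_floor_atTop (α := ℝ)).comp
        (NNReal.tendsto_coe_atTop.2 tendsto_id)).eventually (eventually_ge_atTop _)
    refine squeeze_zero' (Eventually.of_forall fun t => norm_nonneg _) ?_
      (hlim (12 * (‖x i‖ + ‖x i'‖)))
    filter_upwards [hmax] with t ht
    have h0 : (⌊(t : ℝ)⌋₊ : ℝ) ≤ t := Nat.floor_le t.2
    have h1 : (t : ℝ) ≤ ⌊(t : ℝ)⌋₊ + 1 := (Nat.lt_floor_add_one (t : ℝ)).le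
    generalize ⌊(t : ℝ)⌋₊ = m at *
    rw [← Unitization.norm_inr (𝕜 := ℂ), Unitization.inr_sub, Unitization.inr_mul, hMS, hMS, hMS]
    refine (norm_smear_mul_sub_le _ ρ h0 h1 hn (hu' t).inr (C := ‖x i‖ + ‖x i'‖)
      ((hxn i t).trans (le_add_of_nonneg_right (norm_nonneg _)))
      ((hxn i' t).trans (le_add_of_nonneg_left (norm_nonneg _))) (ω := 1 / (m + 1))
      ?_ (hcomm m t h0 h1 i (le_of_max_le_left ht))
      (hcomm m t h0 h1 i' (le_of_max_le_right ht))).trans (le_of_eq ?_)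
    · intro l hl r hr r' hr' hrr
      have hml : m ≤ l := by
        simp only [Finset.mem_insert, Finset.mem_singleton] at hl
        omega
      have hml' : (m : ℝ) ≤ l := by exact_mod_cast hml
      refine (hmesh l i' ((le_of_max_le_right ht).trans hml) t (by linarith) r hr r' hr' hrr).trans ?_
      gcongr
    · have := (zero_lt_one.trans_le (hN m)).ne'
      change _ + N m ^ 2 * _ = _
      field_simp
      ring
  · have hmax : ∀ᶠ t : NNReal in atTop, i ≤ ⌊(t : ℝ)⌋₊ :=
      ((tendsto_nat_floor_atTop (α := ℝ)).comp
        (NNReal.tendsto_coe_atTop.2 tendsto_id)).eventually (eventually_ge_atTop _)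
    refine squeeze_zero' (Eventually.of_forall fun t => norm_nonneg _) ?_
      (by simpa using (hlim 1).add hi)
    filter_upwards [hmax] with t ht
    have h0 : (⌊(t : ℝ)⌋₊ : ℝ) ≤ t := Nat.floor_le t.2
    have h1 : (t : ℝ) ≤ ⌊(t : ℝ)⌋₊ + 1 := (Nat.lt_floor_add_one (t : ℝ)).le
    generalize ⌊(t : ℝ)⌋₊ = m at *
    rw [← Unitization.norm_inr (𝕜 := ℂ), hMS]
    refine (norm_smear_le_of_norm_hatCut_mul_le _ ρ h0 h1 hn _ _ fun p hp hlt =>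
      (htol m _ _ _ (hu' t).inr ?_ p hp).2 hlt ?_).trans (add_le_add_left ?_ _)
    · rw [Unitization.inrNonUnitalStarAlgHom_apply, Unitization.norm_inr]
      exact (NonUnitalStarAlgHom.norm_apply_le _ _).trans ((hyn i t).trans
        ((le_add_of_nonneg_left (norm_nonneg _)).trans (hC m i ht)))
    · rw [Unitization.inrNonUnitalStarAlgHom_apply, ← Unitization.inr_mul,
        ← Unitization.inr_sub, Unitization.norm_inr]
      exact (hq m t h0 h1 i ht p hp).2
    · have h2 := hN m
      change N m * _ ≤ _
      rw [mul_one_div, inv_eq_one_div, div_le_div_iff₀ (by positivity) (by positivity)]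
      have : N m * (m + 1) * 1 ≤ N m * (m + 1) * N m := by gcongr
      linarith

end starLinearMain

end starLinear

section family

open BoundedContinuousFunction

universe u v

theorem tendsto_norm_zero_of_approx {W : Type*} [NormedAddCommGroup W] {f : NNReal → W}
    (h : ∀ ε > 0, ∃ g : NNReal → W, Tendsto (fun t => ‖g t‖) atTop (𝓝 0) ∧
      ∀ t, ‖f t‖ ≤ ‖g t‖ + ε) : Tendsto (fun t => ‖f t‖) atTop (𝓝 0) := by
  refine tendsto_order.2 ⟨fun a ha => Eventually.of_forall fun t => ha.trans_le (norm_nonneg _),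
    fun a ha => ?_⟩
  obtain ⟨g, hg, h⟩ := h (a / 2) (half_pos ha)
  filter_upwards [hg.eventually (eventually_lt_nhds (half_pos ha))] with t ht
  linarith [h t]

theorem exists_seq_dense {Z : Type*} [NormedAddCommGroup Z] {s : Set Z}
    (hs : TopologicalSpace.IsSeparable s) :
    ∃ x : ℕ → Z, (∀ i, x i ∈ insert 0 s) ∧ ∀ z ∈ s, ∀ ε > 0, ∃ i, ‖z - x i‖ < ε := by
  obtain ⟨c, hcs, hc, hd⟩ := hs.exists_countable_dense_subset
  obtain ⟨x, hx⟩ := (hc.insert 0).exists_eq_range (Set.insert_nonempty 0 c)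
  refine ⟨x, fun i => Set.insert_subset_insert hcs (hx ▸ Set.mem_range_self i), fun z hz ε hε => ?_⟩
  obtain ⟨w, hw, hwz⟩ := Metric.mem_closure_iff.1 (hd hz) ε hε
  have : w ∈ Set.range x := hx ▸ Set.mem_insert_of_mem 0 hw
  obtain ⟨i, rfl⟩ := this
  exact ⟨i, by rwa [← dist_eq_norm]⟩

section familyMain
variable {E : Type u} {P : Type v} [NonUnitalCStarAlgebra E] [NonUnitalCStarAlgebra P]

theorem IsStarLinearFamily.norm_mul_sub_le {q : E →⋆ₙₐ[ℂ] P} {M : NNReal → E → E}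
    (hM : IsStarLinearFamily q M) (t : NNReal) {x x' a a' : E} {η : ℝ} (h : ‖x - a‖ ≤ η)
    (h' : ‖x' - a'‖ ≤ η) (hη : η ≤ 1) :
    ‖M t (x * x') - M t x * M t x'‖ ≤
      ‖M t (a * a') - M t a * M t a'‖ + 20 * η * (‖x‖ + ‖x'‖ + 1) := by
  have hη0 : 0 ≤ η := (norm_nonneg _).trans h
  have ha : ‖a‖ ≤ ‖x‖ + 1 := by
    have := norm_sub_norm_le a x
    rw [norm_sub_rev] at this
    linarith
  have hp : ∀ {z w : E} {r s : ℝ}, ‖z‖ ≤ r → ‖w‖ ≤ s → 0 ≤ r → ‖z * w‖ ≤ r * s :=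
    fun hz hw hr => (norm_mul_le _ _).trans (mul_le_mul hz hw (norm_nonneg _) hr)
  have e : M t (x * x') - M t x * M t x' = (M t (a * a') - M t a * M t a') +
      (M t ((x - a) * x') + M t (a * (x' - a')) - (M t (x - a) * M t x' + M t a * M t (x' - a'))) := by
    simp only [sub_mul, mul_sub, hM.sub]
    abel
  have h4 : ∀ {z : E} {r : ℝ}, ‖z‖ ≤ r → ‖M t z‖ ≤ 4 * r := fun hz =>
    (hM.norm_le t _).trans (by linarith)
  have h1 := h4 (hp h le_rfl hη0 (w := x'))
  have h2 := h4 (hp ha h' (by positivity))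
  have h3 := hp (h4 h) (hM.norm_le t x') (by positivity)
  have h5 := hp (h4 ha) (h4 h') (by positivity)
  rw [e]
  refine (norm_add_le _ _).trans (add_le_add_right ((norm_sub_le_of_le (norm_add_le_of_le h1 h2)
    (norm_add_le_of_le h3 h5)).trans (le_of_eq ?_)) _)
  ring

theorem exists_family (q : E →⋆ₙₐ[ℂ] P) (hq : Function.Surjective q) {ρ : ℝ → E →⋆ₙₐ[ℂ] E}
    (hρc : ∀ e, Continuous fun r => ρ r e) (hρ : ∀ e, ρ 1 e = e)
    (hρq : ∀ r e, q e = 0 → q (ρ r e) = 0) {X Y : Set (NNReal →ᵇ E)}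
    (hX : TopologicalSpace.IsSeparable X) (hY : TopologicalSpace.IsSeparable Y)
    (hYq : ∀ y ∈ Y, Tendsto (fun t => ‖q (y t)‖) atTop (𝓝 0))
    (hYρ : ∀ y ∈ Y, Tendsto (fun t => ‖ρ 0 (y t)‖) atTop (𝓝 0)) :
    ∃ M : NNReal → E → E, IsStarLinearFamily q M ∧
      (∀ x ∈ X, ∀ x' ∈ X, Tendsto (fun t => ‖M t (x t * x' t) - M t (x t) * M t (x' t)‖)
        atTop (𝓝 0)) ∧
      ∀ y ∈ Y, Tendsto (fun t => ‖M t (y t)‖) atTop (𝓝 0) := by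
  obtain ⟨σ, hσ, hqσ, hσ0, C, hC⟩ := exists_continuous_rightInverse (starHomCLM q) hq
  obtain ⟨x, -, hxd⟩ := exists_seq_dense hX
  obtain ⟨y, hyY, hyd⟩ := exists_seq_dense hY
  have hyq : ∀ i, Tendsto (fun t => ‖q (y i t)‖) atTop (𝓝 0) := fun i => by
    rcases hyY i with h | h
    · simp [h]
    · exact hYq _ h
  have hyρ : ∀ i, Tendsto (fun t => ‖ρ 0 (y i t)‖) atTop (𝓝 0) := fun i => by
    rcases hyY i with h | h
    · simp [h]
    · exact hYρ _ h
  have hσy : ∀ i, Tendsto (fun t => ‖σ (q (y i t))‖) atTop (𝓝 0) := fun i => by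
    have := (hσ.tendsto 0).comp (tendsto_zero_iff_norm_tendsto_zero.2 (hyq i))
    rw [hσ0] at this
    exact tendsto_zero_iff_norm_tendsto_zero.1 this
  have hC0 : 0 ≤ C := by simpa [hσ0] using hC 0
  let w : ℕ → (NNReal →ᵇ E) := fun i => BoundedContinuousFunction.ofNormedAddCommGroup
    (fun t => σ (q (y i t))) (hσ.comp ((continuous_starHom q).comp (y i).continuous))
    (C * (‖y i‖ + 1)) fun t => (hC _).trans (by
      gcongr
      exact (NonUnitalStarAlgHom.norm_apply_le q _).trans ((y i).norm_coe_le_norm t))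
  have hw : ∀ i, Tendsto (fun t => ‖w i t‖) atTop (𝓝 0) := hσy
  obtain ⟨M, hM, hMX, hMY⟩ := exists_family_of_seq q hρc hρ hρq x (fun i => y i - w i)
    fun i t => by
      change q (y i t - σ (q (y i t))) = 0
      rw [map_sub, sub_eq_zero]
      exact (hqσ _).symm
  refine ⟨M, hM, fun z hz z' hz' => tendsto_norm_zero_of_approx fun ε hε => ?_,
    fun z hz => tendsto_norm_zero_of_approx fun ε hε => ?_⟩
  · let η := min 1 (ε / (20 * (‖z‖ + ‖z'‖ + 1)))
    have hη : 0 < η := by positivity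
    obtain ⟨i, hi⟩ := hxd z hz η hη
    obtain ⟨i', hi'⟩ := hxd z' hz' η hη
    refine ⟨_, hMX i i', fun t => (hM.norm_mul_sub_le t
      (((z - x i).norm_coe_le_norm t).trans hi.le) (((z' - x i').norm_coe_le_norm t).trans hi'.le)
      (min_le_left _ _)).trans (add_le_add_right ?_ _)⟩
    calc 20 * η * (‖z t‖ + ‖z' t‖ + 1) ≤
        20 * (ε / (20 * (‖z‖ + ‖z'‖ + 1))) * (‖z‖ + ‖z'‖ + 1) := by
          gcongr
          · exact min_le_right _ _
          · exact z.norm_coe_le_norm t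
          · exact z'.norm_coe_le_norm t
      _ = ε := by field_simp
  · obtain ⟨i, hi⟩ := hyd z hz (ε / 4) (by positivity)
    have h1 : Tendsto (fun t => ‖ρ 0 ((y i - w i) t)‖) atTop (𝓝 0) := by
      refine squeeze_zero (fun t => norm_nonneg _) (fun t => ?_)
        (by simpa using (hyρ i).add (hw i))
      change ‖ρ 0 (y i t - w i t)‖ ≤ _
      rw [map_sub]
      exact norm_sub_le_of_le le_rfl (NonUnitalStarAlgHom.norm_apply_le _ _)
    refine ⟨fun t => M t (y i t), ?_, fun t => ?_⟩
    · refine squeeze_zero (fun t => norm_nonneg _) (fun t => ?_)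
        (by simpa using (hMY i h1).add ((hw i).const_mul 4))
      have e : M t (y i t) = M t ((y i - w i) t) + M t (w i t) := by
        rw [BoundedContinuousFunction.sub_apply, hM.sub, sub_add_cancel]
      change ‖M t (y i t)‖ ≤ _
      rw [e]
      exact norm_add_le_of_le le_rfl (hM.norm_le t _)
    · have e : M t (z t) = M t (y i t) + M t ((z - y i) t) := by
        rw [BoundedContinuousFunction.sub_apply, hM.sub, add_sub_cancel]
      rw [e]
      refine norm_add_le_of_le le_rfl ((hM.norm_le t _).trans ?_)
      linarith [(z - y i).norm_coe_le_norm t]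

end familyMain

end family

section unitInterval
open BoundedContinuousFunction
variable {D Q : Type*} [NonUnitalCStarAlgebra D] [NonUnitalCStarAlgebra Q]

/-- Postcomposition of paths by a star homomorphism. -/
def pathMap (q : D →⋆ₙₐ[ℂ] Q) : C(unitInterval, D) →⋆ₙₐ[ℂ] C(unitInterval, Q) where
  toFun g := ⟨fun s => q (g s), (continuous_starHom q).comp g.continuous⟩
  map_smul' c g := by ext s; exact map_smul q c (g s)
  map_zero' := by ext s; exact map_zero q
  map_add' g h := by ext s; exact map_add q (g s) (h s)
  map_mul' g h := by ext s; exact map_mul q (g s) (h s)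
  map_star' g := by ext s; exact map_star q (g s)

theorem pathMap_surjective {q : D →⋆ₙₐ[ℂ] Q} (hq : Function.Surjective q) :
    Function.Surjective (pathMap q) := fun g => by
  obtain ⟨σ, hσ, hqσ, -⟩ := exists_continuous_rightInverse (starHomCLM q) hq
  exact ⟨⟨fun s => σ (g s), hσ.comp g.continuous⟩, ContinuousMap.ext fun s => hqσ (g s)⟩

/-- Evaluation of paths. -/
def pathEval (s : unitInterval) : C(unitInterval, D) →⋆ₙₐ[ℂ] D where
  toFun g := g s
  map_smul' _ _ := rfl
  map_zero' := rfl
  map_add' _ _ := rfl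
  map_mul' _ _ := rfl
  map_star' _ := rfl

/-- Constant paths. -/
def pathConst : D →⋆ₙₐ[ℂ] C(unitInterval, D) where
  toFun := ContinuousMap.const unitInterval
  map_smul' _ _ := rfl
  map_zero' := rfl
  map_add' _ _ := rfl
  map_mul' _ _ := rfl
  map_star' _ := rfl

/-- The multiplication `(r, s) ↦ r * s`, clamped to the unit interval. -/
def clampedMul : C(ℝ × unitInterval, unitInterval) :=
  ⟨fun p => Set.projIcc 0 1 zero_le_one (p.1 * p.2), by fun_prop⟩

/-- The contraction of paths to their starting point. -/
def pathScale (r : ℝ) : C(unitInterval, D) →⋆ₙₐ[ℂ] C(unitInterval, D) where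
  toFun g := g.comp (clampedMul.curry r)
  map_smul' _ _ := rfl
  map_zero' := rfl
  map_add' _ _ := rfl
  map_mul' _ _ := rfl
  map_star' _ := rfl

theorem continuous_pathScale (g : C(unitInterval, D)) : Continuous fun r => pathScale r g :=
  (ContinuousMap.curry (g.comp clampedMul)).continuous

theorem pathScale_one (g : C(unitInterval, D)) : pathScale 1 g = g := by
  ext s
  change g (Set.projIcc 0 1 zero_le_one ((1 : ℝ) * s)) = g s
  rw [one_mul, Set.projIcc_val]

theorem pathScale_zero (g : C(unitInterval, D)) : pathScale 0 g = pathConst (pathEval 0 g) := by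
  ext s
  change g (Set.projIcc 0 1 zero_le_one ((0 : ℝ) * s)) = g 0
  rw [zero_mul, Set.projIcc_left]
  rfl

theorem pathMap_pathScale {q : D →⋆ₙₐ[ℂ] Q} (r : ℝ) {g : C(unitInterval, D)}
    (h : pathMap q g = 0) : pathMap q (pathScale r g) = 0 := by
  ext s
  exact congrArg (fun f => f (clampedMul.curry r s)) h

end unitInterval

section defect
open BoundedContinuousFunction
variable {B E : Type*} [NonUnitalCStarAlgebra B] [NonUnitalCStarAlgebra E]

/-- The failures of `x` to be a star homomorphism. -/
def defects (x : B → (NNReal →ᵇ E)) : Set (NNReal →ᵇ E) :=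
  (Set.range fun p : B × B => x (p.1 * p.2) - x p.1 * x p.2) ∪
  (Set.range fun p : (ℂ × ℂ) × B × B => x (p.1.1 • p.2.1 + p.1.2 • p.2.2) -
    (p.1.1 • x p.2.1 + p.1.2 • x p.2.2)) ∪
  Set.range fun a => x (star a) - star (x a)

theorem isSeparable_defects [TopologicalSpace.SeparableSpace B] {x : B → (NNReal →ᵇ E)}
    (hx : Continuous x) : TopologicalSpace.IsSeparable (defects x) := by
  refine ((TopologicalSpace.isSeparable_range ?_).union
    (TopologicalSpace.isSeparable_range ?_)).union (TopologicalSpace.isSeparable_range ?_)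
  all_goals fun_prop

theorem tendsto_norm_map_defects {P : Type*} [NonUnitalCStarAlgebra P] {x : B → (NNReal →ᵇ E)}
    {π : E →⋆ₙₐ[ℂ] P} (h : IsAsymptoticHom fun t b => π (x b t)) {y : NNReal →ᵇ E}
    (hy : y ∈ defects x) : Tendsto (fun t => ‖π (y t)‖) atTop (𝓝 0) := by
  rcases hy with (⟨⟨a, b⟩, rfl⟩ | ⟨⟨⟨μ, ν⟩, a, b⟩, rfl⟩) | ⟨a, rfl⟩
  · refine (h.2.1 a b).congr fun t => ?_
    simp only [BoundedContinuousFunction.sub_apply, BoundedContinuousFunction.mul_apply, map_sub,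
      map_mul]
  · refine (h.2.2.1 μ ν a b).congr fun t => ?_
    simp only [BoundedContinuousFunction.sub_apply, BoundedContinuousFunction.add_apply,
      BoundedContinuousFunction.smul_apply, map_sub, map_add, map_smul]
  · refine (h.2.2.2 a).congr fun t => ?_
    simp only [BoundedContinuousFunction.sub_apply, BoundedContinuousFunction.star_apply, map_sub,
      map_star]

theorem IsStarLinearFamily.isAsymptoticHom {P : Type*} [NonUnitalCStarAlgebra P]
    {q : E →⋆ₙₐ[ℂ] P} {M : NNReal → E → E} (hM : IsStarLinearFamily q M) {x : B → (NNReal →ᵇ E)}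
    (hmul : ∀ a b, Tendsto (fun t => ‖M t (x a t * x b t) - M t (x a t) * M t (x b t)‖)
      atTop (𝓝 0))
    (hd : ∀ y ∈ defects x, Tendsto (fun t => ‖M t (y t)‖) atTop (𝓝 0)) :
    IsAsymptoticHom fun t b => M t (x b t) := by
  refine ⟨fun a => hM.continuous _ (x a).continuous, fun a b => ?_, fun μ ν a b => ?_, fun a => ?_⟩
  · refine squeeze_zero (fun t => norm_nonneg _) (fun t => ?_)
      (by simpa using (hd _ (Or.inl (Or.inl ⟨(a, b), rfl⟩))).add (hmul a b))
    have e : M t (x (a * b) t) - M t (x a t) * M t (x b t) = M t ((x (a * b) - x a * x b) t) +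
        (M t (x a t * x b t) - M t (x a t) * M t (x b t)) := by
      rw [BoundedContinuousFunction.sub_apply, BoundedContinuousFunction.mul_apply, hM.sub,
        sub_add_sub_cancel]
    rw [e]
    exact norm_add_le _ _
  · refine (hd _ (Or.inl (Or.inr ⟨((μ, ν), a, b), rfl⟩))).congr fun t => ?_
    simp only [BoundedContinuousFunction.sub_apply, BoundedContinuousFunction.add_apply,
      BoundedContinuousFunction.smul_apply, hM.sub, hM.add, hM.smul]
  · refine (hd _ (Or.inr ⟨a, rfl⟩)).congr fun t => ?_
    simp only [BoundedContinuousFunction.sub_apply, BoundedContinuousFunction.star_apply, hM.sub,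
      hM.star]

end defect

/-- **Homotopy lifting theorem for asymptotic homomorphisms.**  Let `q : D → D/I` be the
quotient map (modelled as a surjective ∗-homomorphism onto `Q`).  Let `(φ_λ) : B → D/I` be an
asymptotic homomorphism and `ψ : B → D/I` a ∗-homomorphism homotopic to `(φ_λ)` via an
asymptotic homomorphism `(Φ_λ) : B → C([0,1], D/I)` with `ev₁∘Φ_λ = φ_λ` and `ev₀∘Φ_λ = ψ`.
If `ψ` lifts to an asymptotic homomorphism `B → D`, then `(φ_λ)` lifts to an asymptotic
homomorphism, and moreover the whole homotopy lifts. -/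
theorem homotopy_lifting_asymptotic
    {B D Q : Type*} [NonUnitalCStarAlgebra B] [NonUnitalCStarAlgebra D] [NonUnitalCStarAlgebra Q]
    [TopologicalSpace.SeparableSpace B]
    (q : D →⋆ₙₐ[ℂ] Q) (hq : Function.Surjective q)
    (φ : NNReal → B → Q) (hφ : IsAsymptoticHom φ)
    (ψ : B →⋆ₙₐ[ℂ] Q)
    (Φ : NNReal → B → C(unitInterval, Q)) (hΦ : IsAsymptoticHom Φ)
    (hΦ0 : ∀ l b, Φ l b 0 = ψ b) (hΦ1 : ∀ l b, Φ l b 1 = φ l b)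
    (hlift : ∃ F : NNReal → B → D, IsAsymptoticHom F ∧ ∀ t b, q (F t b) = ψ b) :
    (∃ γ : NNReal → B → D, IsAsymptoticHom γ ∧ ∀ l b, q (γ l b) = φ l b) ∧
    (∃ Θ : NNReal → B → C(unitInterval, D), IsAsymptoticHom Θ ∧
      ∀ l b s, q (Θ l b s) = Φ l b s) := by
  obtain ⟨F, hF, hqF⟩ := hlift
  suffices h : ∃ Θ : NNReal → B → C(unitInterval, D), IsAsymptoticHom Θ ∧
      ∀ l b s, q (Θ l b s) = Φ l b s by
    obtain ⟨Θ, hΘ, hqΘ⟩ := h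
    refine ⟨⟨fun t b => Θ t b 1, ?_, fun t b => (hqΘ t b 1).trans (hΦ1 t b)⟩, Θ, hΘ, hqΘ⟩
    have hle : ∀ g : C(unitInterval, D), ‖g 1‖ ≤ ‖g‖ := fun g => g.norm_coe_le_norm 1
    refine ⟨fun a => (continuous_starHom (pathEval 1)).comp (hΘ.1 a), fun a b => ?_,
      fun μ ν a b => ?_, fun a => ?_⟩
    · exact squeeze_zero (fun t => norm_nonneg _) (fun t =>
        hle (Θ t (a * b) - Θ t a * Θ t b)) (hΘ.2.1 a b)
    · exact squeeze_zero (fun t => norm_nonneg _) (fun t =>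
        hle (Θ t (μ • a + ν • b) - (μ • Θ t a + ν • Θ t b))) (hΘ.2.2.1 μ ν a b)
    · exact squeeze_zero (fun t => norm_nonneg _) (fun t =>
        hle (Θ t (star a) - star (Θ t a))) (hΘ.2.2.2 a)
  have hqI := pathMap_surjective hq
  obtain ⟨X, hX, hXΦ⟩ := hΦ.exists_continuous_lift (pathMap q) hqI
  obtain ⟨F', hF', hFF'⟩ := hF.exists_continuous_lift (NonUnitalStarAlgHom.id ℂ D)
    Function.surjective_id
  let x : B → BoundedContinuousFunction NNReal C(unitInterval, D) := fun b =>
    X b + starHomComp pathConst (F' b - starHomComp (pathEval 0) (X b))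
  have hx : Continuous x := hX.add ((continuous_starHom _).comp
    (hF'.sub ((continuous_starHom _).comp hX)))
  have hx0 : ∀ b t, x b t 0 = F' b t := fun b t => add_sub_cancel (X b t 0) (F' b t)
  have hxF : IsAsymptoticHom fun t b => pathEval 0 (x b t) :=
    hF.congr (fun a => (continuous_starHom _).comp (x a).continuous) fun a =>
      (hFF' a).congr fun t => by
        change ‖F' a t - F t a‖ = ‖x a t 0 - F t a‖
        rw [hx0]
  have hxΦ : ∀ b, Tendsto (fun t => ‖pathMap q (x b t) - Φ t b‖) atTop (𝓝 0) := fun b => by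
    refine squeeze_zero (fun t => norm_nonneg _) (fun t => ?_)
      (by simpa using (hXΦ b).add ((hFF' b).add (hXΦ b)))
    have e : pathMap q (x b t) - Φ t b = (pathMap q (X b t) - Φ t b) +
        pathConst (q (F' b t - F t b) - pathEval 0 (pathMap q (X b t) - Φ t b)) := by
      ext s
      change q (X b t s + (F' b t - X b t 0)) - Φ t b s = (q (X b t s) - Φ t b s) +
        (q (F' b t - F t b) - (q (X b t 0) - Φ t b 0))
      rw [map_add, map_sub, map_sub, hqF, hΦ0]
      abel
    rw [e]
    exact norm_add_le_of_le le_rfl ((NonUnitalStarAlgHom.norm_apply_le _ _).trans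
      (norm_sub_le_of_le (NonUnitalStarAlgHom.norm_apply_le _ _)
        (NonUnitalStarAlgHom.norm_apply_le _ _)))
  have hxq : IsAsymptoticHom fun t b => pathMap q (x b t) :=
    hΦ.congr (fun a => (continuous_starHom _).comp (x a).continuous) hxΦ
  obtain ⟨M, hM, hMmul, hMd⟩ := exists_family (pathMap q) hqI continuous_pathScale pathScale_one
    (fun r _ => pathMap_pathScale r) (TopologicalSpace.isSeparable_range hx)
    (isSeparable_defects hx) (fun y hy => tendsto_norm_map_defects hxq hy) fun y hy =>
      squeeze_zero (fun t => norm_nonneg _) (fun t => by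
        rw [pathScale_zero]
        exact NonUnitalStarAlgHom.norm_apply_le _ _) (tendsto_norm_map_defects hxF hy)
  have hMx := hM.isAsymptoticHom (fun a b => hMmul _ ⟨a, rfl⟩ _ ⟨b, rfl⟩) hMd
  obtain ⟨σ, hσ, hqσ, hσ0, -⟩ := exists_continuous_rightInverse (starHomCLM (pathMap q)) hqI
  have hlim : ∀ b, Tendsto (fun t => ‖σ (Φ t b - pathMap q (x b t))‖) atTop (𝓝 0) := fun b => by
    have h1 : Tendsto (fun t => Φ t b - pathMap q (x b t)) atTop (𝓝 0) :=
      tendsto_zero_iff_norm_tendsto_zero.2 ((hxΦ b).congr fun t => norm_sub_rev _ _)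
    have h2 := (hσ.tendsto 0).comp h1
    rw [hσ0] at h2
    exact tendsto_zero_iff_norm_tendsto_zero.1 h2
  refine ⟨fun t b => M t (x b t) + σ (Φ t b - pathMap q (x b t)), hMx.congr (fun a =>
    (hMx.1 a).add (hσ.comp ((hΦ.1 a).sub (hxq.1 a)))) fun a =>
      (hlim a).congr fun t => by rw [add_sub_cancel_left], fun t b s => ?_⟩
  have h : pathMap q (M t (x b t) + σ (Φ t b - pathMap q (x b t))) = Φ t b := by
    have h1 : pathMap q (σ (Φ t b - pathMap q (x b t))) = Φ t b - pathMap q (x b t) := hqσ _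
    rw [map_add, hM.map, h1, add_sub_cancel]
  exact congrArg (fun f => f s) h

end
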